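/- For every integer n ≥ 3 there exist a Ważewski dendrite X of order n and a finitely generated subgroup G of Homeo(X), dense in Homeo(X), such that for every branch point p of X and every permutation σ of the set of connected components of X \ {p}, there exists g ∈ G with g(p) = p and g(B) = σ(B) for every connected component B of X \ {p}; that is, the stabilizer of p in G induces the full symmetric group Sym(n) on the n branches at p. -/

import Mathlib

open Topology

/-- The set of connected components of a subset `S` of `X`. -/
def setComponents (X : Type*) [TopologicalSpace X] (S : Set X) : Set (Set X) :=
  {C | ∃ x ∈ S, C = connectedComponentIn S x}

/-- The order of a point `p` of `X`: the number of connected components of `X \ {p}`. -/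
noncomputable def ptOrder (X : Type*) [TopologicalSpace X] (p : X) : ℕ :=
  (setComponents X {p}ᶜ).ncard

/-- A dendrite: a nonempty, compact, connected, locally connected metrizable space
containing no subspace homeomorphic to the circle. -/
def IsDendrite (X : Type*) [TopologicalSpace X] : Prop :=
  Nonempty X ∧ CompactSpace X ∧ ConnectedSpace X ∧ LocallyConnectedSpace X ∧
    TopologicalSpace.MetrizableSpace X ∧
    ∀ S : Set X, IsEmpty (S ≃ₜ Circle)

/-- A Ważewski dendrite of order `n`: a dendrite all of whose points have order `1`, `2`
or `n`, and every arc (subspace homeomorphic to `[0,1]`) contains a point of order `n`. -/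
def IsWazewskiDendrite (n : ℕ) (X : Type*) [TopologicalSpace X] : Prop :=
  IsDendrite X ∧
  (∀ p : X, ptOrder X p = 1 ∨ ptOrder X p = 2 ∨ ptOrder X p = n) ∧
  ∀ A : Set X, Nonempty (A ≃ₜ unitInterval) → ∃ p ∈ A, ptOrder X p = n

/-- The group structure on self-homeomorphisms of `X`, with composition as product. -/
instance Homeomorph.instGroupSelf (X : Type*) [TopologicalSpace X] : Group (X ≃ₜ X) where
  mul f g := g.trans f
  one := Homeomorph.refl X
  inv := Homeomorph.symm
  mul_assoc _ _ _ := rfl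
  one_mul _ := Homeomorph.ext fun _ => rfl
  mul_one _ := Homeomorph.ext fun _ => rfl
  inv_mul_cancel := Homeomorph.self_trans_symm

/-- The compact-open topology on the group of self-homeomorphisms of `X` (for compact
metric `X`, this is the topology of uniform convergence). -/
instance Homeomorph.instTopSelf (X : Type*) [TopologicalSpace X] :
    TopologicalSpace (X ≃ₜ X) :=
  TopologicalSpace.induced (fun h : X ≃ₜ X => (h : C(X, X))) ContinuousMap.compactOpen

namespace Waz

/-- Sequences over the alphabet. -/
abbrev Sq (m : ℕ) := ℕ → Fin (m + 3)

/-- The gluing relation. -/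
def R {m : ℕ} (s t : Sq m) : Prop :=
  ∀ k, s k ≠ t k → (∀ j, j ≠ k → s j = t j) ∧ s (k + 1) = 0 ∧ ∀ j, k + 1 < j → s j = 1

theorem R_symm {m : ℕ} {s t : Sq m} (h : R s t) : R t s := by
  intro k hk
  obtain ⟨h1, h2, h3⟩ := h k (Ne.symm hk)
  refine ⟨fun j hj => (h1 j hj).symm, ?_, ?_⟩
  · rw [← h1 (k + 1) (by omega)]; exact h2
  · intro j hj
    rw [← h1 j (by omega)]; exact h3 j hj

theorem tail_unique {m : ℕ} {t : Sq m} {k j : ℕ} (h1 : t (k + 1) = 0)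
    (h2 : ∀ l, k + 1 < l → t l = 1) (h3 : t (j + 1) = 0) (h4 : ∀ l, j + 1 < l → t l = 1) :
    j = k := by
  rcases lt_trichotomy j k with h | h | h
  · have := h4 (k + 1) (by omega)
    rw [h1] at this; exact absurd this (by simp)
  · exact h
  · have := h2 (j + 1) (by omega)
    rw [h3] at this; exact absurd this (by simp)

theorem R_trans_aux {m : ℕ} {s t u : Sq m} (h : R s t) (h' : R t u) (k : ℕ) (hk : s k ≠ t k) :
    (∀ j, j ≠ k → s j = u j) ∧ s (k + 1) = 0 ∧ ∀ j, k + 1 < j → s j = 1 := by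
  obtain ⟨h1, h2, h3⟩ := h k hk
  refine ⟨fun j hj => ?_, h2, h3⟩
  rw [h1 j hj]
  by_contra hne
  obtain ⟨g1, g2, g3⟩ := h' j hne
  apply hj
  refine tail_unique (t := t) ?_ ?_ g2 g3
  · rw [← h1 (k + 1) (by omega)]; exact h2
  · intro l hl
    rw [← h1 l (by omega)]; exact h3 l hl

theorem R_trans {m : ℕ} {s t u : Sq m} (h : R s t) (h' : R t u) : R s u := by
  intro k hk
  by_cases h1 : s k = t k
  · have h2 : u k ≠ t k := fun e => hk (by rw [h1, e])
    obtain ⟨a1, a2, a3⟩ := R_trans_aux (R_symm h') (R_symm h) k h2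
    refine ⟨fun j hj => (a1 j hj).symm, ?_, ?_⟩
    · rw [← a1 (k + 1) (by omega)]; exact a2
    · intro l hl
      rw [← a1 l (by omega)]; exact a3 l hl
  · exact R_trans_aux h h' k h1

theorem R_refl {m : ℕ} (s : Sq m) : R s s := fun _ h => absurd rfl h

/-- The setoid. -/
def setoid (m : ℕ) : Setoid (Sq m) :=
  ⟨R, fun _ _ h => absurd rfl h, R_symm, R_trans⟩

/-- The dendrite. -/
def WX (m : ℕ) : Type := Quotient (setoid m)

instance (m : ℕ) : TopologicalSpace (WX m) :=
  inferInstanceAs (TopologicalSpace (Quotient (setoid m)))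

/-- The projection. -/
def mk {m : ℕ} (s : Sq m) : WX m := Quotient.mk (setoid m) s

theorem mk_eq {m : ℕ} {s t : Sq m} : mk s = mk t ↔ R s t := by
  exact Quotient.eq (r := setoid m)

theorem mk_surj {m : ℕ} : Function.Surjective (mk (m := m)) := Quotient.mk_surjective

theorem isQuotientMap_mk {m : ℕ} : IsQuotientMap (mk (m := m)) := isQuotientMap_quot_mk

theorem continuous_mk {m : ℕ} : Continuous (mk (m := m)) := isQuotientMap_mk.continuous

instance (m : ℕ) : CompactSpace (WX m) :=
  inferInstanceAs (CompactSpace (Quotient (setoid m)))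

instance (m : ℕ) : Nonempty (WX m) := ⟨mk fun _ => 0⟩

theorem isClosed_R (m : ℕ) : IsClosed {p : Sq m × Sq m | R p.1 p.2} := by
  have hc : ∀ k, Continuous fun p : Sq m × Sq m => p.1 k := fun k => by fun_prop
  have hd : ∀ k, Continuous fun p : Sq m × Sq m => p.2 k := fun k => by fun_prop
  have : {p : Sq m × Sq m | R p.1 p.2} = ⋂ k, ({p | p.1 k = p.2 k} ∪
      ((⋂ j, ⋂ (_ : j ≠ k), {p | p.1 j = p.2 j}) ∩ ({p | p.1 (k + 1) = 0} ∩
        ⋂ j, ⋂ (_ : k + 1 < j), {p | p.1 j = 1}))) := by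
    ext p
    simp only [R, Set.mem_ofPred_eq, Set.mem_iInter, Set.mem_union, Set.mem_inter_iff]
    exact forall_congr' fun k => by tauto
  rw [this]
  refine isClosed_iInter fun k => (isClosed_eq (hc k) (hd k)).union (IsClosed.inter ?_
    (IsClosed.inter ?_ ?_))
  · exact isClosed_iInter fun j => isClosed_iInter fun _ => isClosed_eq (hc j) (hd j)
  · exact isClosed_eq (hc _) continuous_const
  · exact isClosed_iInter fun j => isClosed_iInter fun _ => isClosed_eq (hc j) continuous_const

theorem isClosedMap_mk {m : ℕ} : IsClosedMap (mk (m := m)) := by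
  intro C hC
  rw [← isQuotientMap_mk.isClosed_preimage]
  have : mk ⁻¹' (mk '' C) = Prod.snd '' ({p : Sq m × Sq m | R p.1 p.2} ∩ Prod.fst ⁻¹' C) := by
    ext t
    constructor
    · rintro ⟨s, hs, h⟩
      exact ⟨(s, t), ⟨mk_eq.1 h, hs⟩, rfl⟩
    · rintro ⟨⟨s, t'⟩, ⟨h, hs⟩, rfl⟩
      exact ⟨s, hs, mk_eq.2 h⟩
  rw [this]
  exact (((isClosed_R m).inter (hC.preimage continuous_fst)).isCompact.image
    continuous_snd).isClosed

instance (m : ℕ) : T2Space (WX m) := by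
  have hcl : ∀ x : WX m, IsClosed ({x} : Set (WX m)) := by
    intro x
    obtain ⟨s, rfl⟩ := mk_surj x
    simpa using isClosedMap_mk _ (isClosed_singleton (x := s))
  refine ⟨fun x y hxy => ?_⟩
  obtain ⟨U, V, hU, hV, hxU, hyV, hUV⟩ := normal_separation
    ((hcl x).preimage (continuous_mk (m := m))) ((hcl y).preimage continuous_mk)
    (by
      rw [Set.disjoint_left]
      intro s h1 h2
      exact hxy (h1.symm.trans h2))
  refine ⟨(mk '' Uᶜ)ᶜ, (mk '' Vᶜ)ᶜ, (isClosedMap_mk _ hU.isClosed_compl).isOpen_compl,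
    (isClosedMap_mk _ hV.isClosed_compl).isOpen_compl, ?_, ?_, ?_⟩
  · rintro ⟨s, hs, h⟩
    exact hs (hxU h)
  · rintro ⟨s, hs, h⟩
    exact hs (hyV h)
  · rw [Set.disjoint_left]
    intro z h1 h2
    obtain ⟨s, rfl⟩ := mk_surj z
    have hsU : s ∈ U := by
      by_contra h; exact h1 ⟨s, h, rfl⟩
    have hsV : s ∈ V := by
      by_contra h; exact h2 ⟨s, h, rfl⟩
    exact Set.disjoint_left.1 hUV hsU hsV

/-- Prepend a letter. -/
def cons {m : ℕ} (i : Fin (m + 3)) (s : Sq m) : Sq m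
  | 0 => i
  | k + 1 => s k

theorem cons_tail {m : ℕ} (s : Sq m) : cons (s 0) (fun k => s (k + 1)) = s := by
  funext k; cases k <;> rfl

theorem R_cons {m : ℕ} {i : Fin (m + 3)} {s t : Sq m} : R (cons i s) (cons i t) ↔ R s t := by
  constructor
  · intro h k hk
    obtain ⟨h1, h2, h3⟩ := h (k + 1) hk
    exact ⟨fun j hj => h1 (j + 1) (by omega), h2, fun j hj => h3 (j + 1) (by omega)⟩
  · intro h k hk
    cases k with
    | zero => exact absurd rfl hk
    | succ k =>
      obtain ⟨h1, h2, h3⟩ := h k hk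
      refine ⟨fun j hj => ?_, h2, fun j hj => ?_⟩
      · cases j with
        | zero => rfl
        | succ j => exact h1 j (by omega)
      · cases j with
        | zero => omega
        | succ j => exact h3 j (by omega)

variable {m : ℕ}

/-- The contraction maps. -/
def f (i : Fin (m + 3)) : WX m → WX m :=
  Quotient.map (sa := setoid m) (sb := setoid m) (cons i) fun _ _ h => R_cons.2 h

theorem f_mk (i : Fin (m + 3)) (s : Sq m) : f i (mk s) = mk (cons i s) := rfl

/-- Endpoint `b`. -/
def b : WX m := mk fun _ => 1

/-- Endpoint `a`. -/
def a : WX m := f 0 b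

/-- Centre. -/
def c : WX m := f 0 a

theorem f_zero_b : f 0 (b : WX m) = a := rfl

theorem f_one_b : f 1 (b : WX m) = b := by
  unfold b; rw [f_mk]; congr 1
  funext k; cases k <;> rfl

theorem f_inj {i : Fin (m + 3)} {x y : WX m} : f i x = f i y ↔ x = y := by
  obtain ⟨s, rfl⟩ := mk_surj x
  obtain ⟨t, rfl⟩ := mk_surj y
  rw [f_mk, f_mk, mk_eq, mk_eq, R_cons]

theorem f_a (i j : Fin (m + 3)) : f i (a : WX m) = f j a := by
  unfold a b
  rw [f_mk, f_mk, f_mk, mk_eq]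
  intro k hk
  cases k with
  | zero =>
    refine ⟨fun l hl => ?_, rfl, fun l hl => ?_⟩
    · cases l with
      | zero => exact absurd rfl hl
      | succ l => rfl
    · match l, hl with
      | l + 2, _ => rfl
  | succ k => exact absurd rfl hk

theorem f_a_eq (i : Fin (m + 3)) : f i (a : WX m) = c := f_a i 0

theorem f_eq_of_ne {i j : Fin (m + 3)} (hij : i ≠ j) {x y : WX m} :
    f i x = f j y ↔ x = a ∧ y = a := by
  constructor
  · obtain ⟨s, rfl⟩ := mk_surj x
    obtain ⟨t, rfl⟩ := mk_surj y
    intro h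
    rw [f_mk, f_mk, mk_eq] at h
    obtain ⟨h1, h2, h3⟩ := h 0 hij
    have hst : s = t := by
      funext k; exact h1 (k + 1) (by omega)
    subst hst
    have : mk s = a := by
      unfold a b
      rw [f_mk]; congr 1
      funext k
      cases k with
      | zero => exact h2
      | succ k => exact h3 (k + 2) (by omega)
    exact ⟨this, this⟩
  · rintro ⟨rfl, rfl⟩; exact f_a i j

theorem f_surj (x : WX m) : ∃ i y, x = f i y := by
  obtain ⟨s, rfl⟩ := mk_surj x
  exact ⟨s 0, mk fun k => s (k + 1), by rw [f_mk, cons_tail]⟩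

theorem a_ne_b : (a : WX m) ≠ b := by
  unfold a b
  rw [f_mk]
  intro h
  rw [mk_eq] at h
  have := (h 0 (by simp [cons])).2.1
  simp [cons] at this

theorem f_eq_a {i : Fin (m + 3)} {x : WX m} : f i x = a ↔ i = 0 ∧ x = b := by
  constructor
  · intro h
    by_cases hi : i = 0
    · subst hi
      rw [← f_zero_b, f_inj] at h
      exact ⟨rfl, h⟩
    · rw [← f_zero_b, f_eq_of_ne hi] at h
      exact absurd h.2.symm a_ne_b
  · rintro ⟨rfl, rfl⟩; rfl

theorem f_eq_b {i : Fin (m + 3)} {x : WX m} : f i x = b ↔ i = 1 ∧ x = b := by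
  constructor
  · intro h
    by_cases hi : i = 1
    · subst hi
      rw [← f_one_b, f_inj] at h
      exact ⟨rfl, h⟩
    · rw [← f_one_b, f_eq_of_ne hi] at h
      exact absurd h.2.symm a_ne_b
  · rintro ⟨rfl, rfl⟩; exact f_one_b

theorem f_eq_c {i : Fin (m + 3)} {x : WX m} : f i x = c ↔ x = a := by
  rw [← f_a_eq i, f_inj]

theorem c_ne_a : (c : WX m) ≠ a := by
  intro h; unfold c at h
  exact a_ne_b (f_eq_a.1 h).2

theorem c_ne_b : (c : WX m) ≠ b := by
  intro h; unfold c at h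
  exact a_ne_b (f_eq_b.1 h).2

theorem continuous_cons (i : Fin (m + 3)) : Continuous (cons i : Sq m → Sq m) := by
  refine continuous_pi fun k => ?_
  cases k with
  | zero => exact continuous_const
  | succ k => exact continuous_apply k

theorem continuous_f (i : Fin (m + 3)) : Continuous (f i : WX m → WX m) := by
  rw [isQuotientMap_mk.continuous_iff]
  exact continuous_mk.comp (continuous_cons i)

theorem isClosedMap_f (i : Fin (m + 3)) : IsClosedMap (f i : WX m → WX m) :=
  (continuous_f i).isClosedMap

theorem isClosed_range_f (i : Fin (m + 3)) : IsClosed (Set.range (f i : WX m → WX m)) :=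
  (isClosedMap_f i).isClosed_range

theorem exists_glue {Y : Type*} [TopologicalSpace Y] (g : Fin (m + 3) → WX m → Y)
    (hg : ∀ i, Continuous (g i)) (q : Y) (hq : ∀ i, g i a = q) :
    ∃ F : WX m → Y, Continuous F ∧ ∀ i x, F (f i x) = g i x := by
  choose I Z hIZ using f_surj (m := m)
  have key : ∀ i x, g (I (f i x)) (Z (f i x)) = g i x := by
    intro i x
    have h := hIZ (f i x)
    generalize I (f i x) = j at *
    generalize Z (f i x) = z at *
    by_cases hij : i = j
    · subst hij
      rw [f_inj] at h; rw [h]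
    · rw [f_eq_of_ne hij] at h
      rw [h.1, h.2, hq, hq]
  refine ⟨fun x => g (I x) (Z x), ?_, key⟩
  have hqm : IsQuotientMap (fun p : Fin (m + 3) × WX m => f p.1 p.2) := by
    refine IsQuotientMap.of_surjective_continuous ?_ ?_
    · intro x
      obtain ⟨i, y, rfl⟩ := f_surj x
      exact ⟨(i, y), rfl⟩
    · exact continuous_prod_of_discrete_left.2 continuous_f
  rw [hqm.continuous_iff]
  refine continuous_prod_of_discrete_left.2 fun i => ?_
  have : (fun x => ((fun x => g (I x) (Z x)) ∘ fun p : Fin (m + 3) × WX m => f p.1 p.2) (i, x))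
      = g i := funext fun x => key i x
  rw [this]; exact hg i

/-- Gluing maps along the common point. -/
noncomputable def glue {Y : Type*} [TopologicalSpace Y] (g : Fin (m + 3) → WX m → Y)
    (hg : ∀ i, Continuous (g i)) (q : Y) (hq : ∀ i, g i a = q) : WX m → Y :=
  (exists_glue g hg q hq).choose

theorem continuous_glue {Y : Type*} [TopologicalSpace Y] (g : Fin (m + 3) → WX m → Y)
    (hg : ∀ i, Continuous (g i)) (q : Y) (hq : ∀ i, g i a = q) : Continuous (glue g hg q hq) :=
  (exists_glue g hg q hq).choose_spec.1

theorem glue_f {Y : Type*} [TopologicalSpace Y] (g : Fin (m + 3) → WX m → Y)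
    (hg : ∀ i, Continuous (g i)) (q : Y) (hq : ∀ i, g i a = q) (i : Fin (m + 3)) (x : WX m) :
    glue g hg q hq (f i x) = g i x :=
  (exists_glue g hg q hq).choose_spec.2 i x

/-- Words acting on the space. -/
def fw (w : List (Fin (m + 3))) (x : WX m) : WX m := w.foldr f x

@[simp] theorem fw_nil (x : WX m) : fw [] x = x := rfl

@[simp] theorem fw_cons (i : Fin (m + 3)) (w : List (Fin (m + 3))) (x : WX m) :
    fw (i :: w) x = f i (fw w x) := rfl

theorem fw_append (v w : List (Fin (m + 3))) (x : WX m) :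
    fw (v ++ w) x = fw v (fw w x) := by
  induction v with
  | nil => rfl
  | cons i v ih => simp [ih]

theorem fw_inj {w : List (Fin (m + 3))} {x y : WX m} : fw w x = fw w y ↔ x = y := by
  induction w with
  | nil => rfl
  | cons i w ih => simp [f_inj, ih]

theorem continuous_fw (w : List (Fin (m + 3))) : Continuous (fw w : WX m → WX m) := by
  induction w with
  | nil => exact continuous_id
  | cons i w ih => exact (continuous_f i).comp ih

theorem isClosed_range_fw (w : List (Fin (m + 3))) :
    IsClosed (Set.range (fw w : WX m → WX m)) :=
  (isCompact_range (continuous_fw w)).isClosed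

theorem fw_surj (k : ℕ) (x : WX m) : ∃ w : List (Fin (m + 3)), w.length = k ∧ ∃ y, x = fw w y := by
  induction k generalizing x with
  | zero => exact ⟨[], rfl, x, rfl⟩
  | succ k ih =>
    obtain ⟨i, y, rfl⟩ := f_surj x
    obtain ⟨w, hw, z, rfl⟩ := ih y
    exact ⟨i :: w, by simp [hw], z, rfl⟩

/-- A branch point. -/
def Br (x : WX m) : Prop := ∃ w, x = fw w c

theorem fw_c_ne_b (w : List (Fin (m + 3))) : fw w c ≠ (b : WX m) := by
  induction w with
  | nil => exact c_ne_b
  | cons i w ih => exact fun h => ih (f_eq_b.1 h).2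

theorem fw_c_ne_a (w : List (Fin (m + 3))) : fw w c ≠ (a : WX m) := by
  cases w with
  | nil => exact c_ne_a
  | cons i w => exact fun h => fw_c_ne_b w (f_eq_a.1 h).2

theorem not_br_a : ¬ Br (a : WX m) := fun ⟨w, h⟩ => fw_c_ne_a w h.symm

theorem not_br_b : ¬ Br (b : WX m) := fun ⟨w, h⟩ => fw_c_ne_b w h.symm

theorem br_c : Br (c : WX m) := ⟨[], rfl⟩

theorem Br.f {x : WX m} (h : Br x) (i : Fin (m + 3)) : Br (f i x) := by
  obtain ⟨w, rfl⟩ := h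
  exact ⟨i :: w, rfl⟩

/-- Preimage of a cell as a set of sequences sharing a prefix. -/
theorem mk_fw_prefix (k : ℕ) (w : List (Fin (m + 3))) (hw : w.length = k) :
    ∃ s0 : Sq m, ∀ t : Sq m, (∀ j < k, t j = s0 j) ↔ ∃ u : Sq m, mk t = fw w (mk u) ∧
      t = w.foldr cons u := by
  induction w generalizing k with
  | nil =>
    simp only [List.length_nil] at hw
    subst hw
    exact ⟨fun _ => 0, fun t => by simp⟩
  | cons i w ih =>
    obtain ⟨s0, hs0⟩ := ih w.length rfl
    refine ⟨cons i s0, fun t => ?_⟩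
    simp only [List.length_cons] at hw
    subst hw
    constructor
    · intro h
      have h0 : t 0 = i := h 0 (by omega)
      obtain ⟨u, hu1, hu2⟩ := (hs0 (fun k => t (k + 1))).1 fun j hj => h (j + 1) (by omega)
      refine ⟨u, ?_, ?_⟩
      · rw [fw_cons, ← hu1, f_mk, ← h0, cons_tail]
      · rw [List.foldr_cons, ← hu2, ← h0, cons_tail]
    · rintro ⟨u, -, rfl⟩ j hj
      cases j with
      | zero => rfl
      | succ j =>
        exact (hs0 (w.foldr cons u)).2 ⟨u, by
          clear hs0 ih hj
          induction w with
          | nil => rfl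
          | cons i w ih => rw [List.foldr_cons, fw_cons, ← ih, f_mk], rfl⟩ j (by omega)

theorem mk_foldr (w : List (Fin (m + 3))) (u : Sq m) : mk (w.foldr cons u) = fw w (mk u) := by
  induction w with
  | nil => rfl
  | cons i w ih => rw [List.foldr_cons, fw_cons, ← ih, f_mk]

/-- Cells shrink. -/
theorem shrink {K U : Set (WX m)} (hK : IsCompact K) (hU : IsOpen U) (hKU : K ⊆ U) :
    ∃ k₀, ∀ k, k₀ ≤ k → ∀ w : List (Fin (m + 3)), w.length = k →
      (∃ x ∈ K, x ∈ Set.range (fw w)) → Set.range (fw w) ⊆ U := by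
  have hK' : IsCompact (mk (m := m) ⁻¹' K) := (hK.isClosed.preimage continuous_mk).isCompact
  have main : ∃ k₀, ∀ z ∈ mk (m := m) ⁻¹' K, ∀ t : Sq m, (∀ j < k₀, t j = z j) → mk t ∈ U := by
    refine hK'.induction_on (p := fun S => ∃ k₀, ∀ z ∈ S, ∀ t : Sq m, (∀ j < k₀, t j = z j) →
      mk t ∈ U) ⟨0, by simp⟩ ?_ ?_ ?_
    · rintro S T hST ⟨k, hk⟩
      exact ⟨k, fun z hz => hk z (hST hz)⟩
    · rintro S T ⟨k, hk⟩ ⟨l, hl⟩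
      refine ⟨max k l, ?_⟩
      rintro z (hz | hz) t ht
      · exact hk z hz t fun j hj => ht j (lt_max_of_lt_left hj)
      · exact hl z hz t fun j hj => ht j (lt_max_of_lt_right hj)
    · intro z hz
      have hopen : IsOpen (mk (m := m) ⁻¹' U) := hU.preimage continuous_mk
      have hzU : z ∈ mk (m := m) ⁻¹' U := hKU hz
      rw [isOpen_pi_iff] at hopen
      obtain ⟨I, u, hu, hsub⟩ := hopen z hzU
      refine ⟨{t : Sq m | ∀ j < I.sup id + 1, t j = z j}, mem_nhdsWithin_of_mem_nhds ?_,
        I.sup id + 1, ?_⟩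
      · have : {t : Sq m | ∀ j < I.sup id + 1, t j = z j} =
            ⋂ j ∈ Finset.range (I.sup id + 1), {t : Sq m | t j = z j} := by
          ext t; simp
        rw [this]
        refine (isOpen_biInter_finset fun j _ => ?_).mem_nhds (by simp)
        exact (continuous_apply j : Continuous fun t : Sq m => t j).isOpen_preimage {z j}
          (isOpen_discrete _)
      · intro z' hz' t ht
        refine hsub fun j hj => ?_
        have hj' : j < I.sup id + 1 := Nat.lt_succ_of_le (Finset.le_sup (f := id) hj)
        rw [ht j hj', hz' j hj']
        exact (hu j hj).2
  obtain ⟨k₀, hk₀⟩ := main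
  refine ⟨k₀, fun k hk w hw => ?_⟩
  rintro ⟨x, hxK, y, rfl⟩
  rintro _ ⟨y', rfl⟩
  obtain ⟨u, rfl⟩ := mk_surj y
  obtain ⟨u', rfl⟩ := mk_surj y'
  obtain ⟨s0, hs0⟩ := mk_fw_prefix k w hw
  have h1 := (hs0 (w.foldr cons u)).2 ⟨u, mk_foldr w u, rfl⟩
  have h2 := (hs0 (w.foldr cons u')).2 ⟨u', mk_foldr w u', rfl⟩
  rw [← mk_foldr]
  refine hk₀ (w.foldr cons u) ?_ _ fun j hj => ?_
  · rw [Set.mem_preimage, mk_foldr]; exact hxK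
  · rw [h1 j (by omega), h2 j (by omega)]

end Waz

namespace Waz

variable {m : ℕ}

instance : PreconnectedSpace (WX m) := by
  rw [preconnectedSpace_iff_clopen]
  intro U hU
  obtain ⟨k1, h1⟩ := shrink hU.1.isCompact hU.2 subset_rfl
  obtain ⟨k2, h2⟩ := shrink hU.compl.1.isCompact hU.compl.2 subset_rfl
  have key : ∀ d, ∀ w : List (Fin (m + 3)), w.length + d = max k1 k2 →
      Set.range (fw w) ⊆ U ∨ Set.range (fw w) ⊆ Uᶜ := by
    intro d
    induction d with
    | zero =>
      intro w hw
      by_cases h : fw w c ∈ U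
      · exact Or.inl (h1 _ (by omega) w rfl ⟨_, h, _, rfl⟩)
      · exact Or.inr (h2 _ (by omega) w rfl ⟨_, h, _, rfl⟩)
    | succ d ih =>
      intro w hw
      have hmem : ∀ i, fw w (c : WX m) ∈ Set.range (fw (w ++ [i])) := fun i =>
        ⟨a, by rw [fw_append]; simp [f_a_eq]⟩
      have hcov : ∀ y, ∃ i, fw w y ∈ Set.range (fw (w ++ [i])) := by
        intro y
        obtain ⟨i, z, rfl⟩ := f_surj y
        exact ⟨i, z, by rw [fw_append]; rfl⟩
      have hi := fun i => ih (w ++ [i]) (by simp; omega)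
      by_cases h : fw w (c : WX m) ∈ U
      · left
        rintro _ ⟨y, rfl⟩
        obtain ⟨i, hy⟩ := hcov y
        rcases hi i with h' | h'
        · exact h' hy
        · exact absurd h (h' (hmem i))
      · right
        rintro _ ⟨y, rfl⟩
        obtain ⟨i, hy⟩ := hcov y
        rcases hi i with h' | h'
        · exact absurd (h' (hmem i)) h
        · exact h' hy
  rcases key (max k1 k2) [] (by simp) with h | h
  · right
    exact Set.eq_univ_of_forall fun x => h ⟨x, rfl⟩
  · left
    exact Set.eq_empty_of_forall_notMem fun x hx => h ⟨x, rfl⟩ hx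

instance : ConnectedSpace (WX m) where
  toNonempty := inferInstance

theorem isPreconnected_range_fw (w : List (Fin (m + 3))) :
    IsPreconnected (Set.range (fw w : WX m → WX m)) :=
  isPreconnected_range (continuous_fw w)

theorem isPreconnected_range_f (w : Fin (m + 3)) :
    IsPreconnected (Set.range (f w : WX m → WX m)) :=
  isPreconnected_range (continuous_f w)

theorem finite_words (k : ℕ) : {w : List (Fin (m + 3)) | w.length = k}.Finite :=
  List.finite_length_eq _ k

/-- Cell neighbourhoods. -/
theorem cell_nhds (x : WX m) {U : Set (WX m)} (hU : U ∈ 𝓝 x) :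
    ∃ S : Set (List (Fin (m + 3))), S.Finite ∧ (∀ w ∈ S, x ∈ Set.range (fw w)) ∧
      (⋃ w ∈ S, Set.range (fw w)) ∈ 𝓝 x ∧ (⋃ w ∈ S, Set.range (fw w)) ⊆ U := by
  obtain ⟨V, hVU, hV, hxV⟩ := mem_nhds_iff.1 hU
  obtain ⟨k, hk⟩ := shrink (isCompact_singleton (x := x)) hV (by simpa using hxV)
  refine ⟨{w | w.length = k ∧ x ∈ Set.range (fw w)}, (finite_words k).subset fun w hw => hw.1,
    fun w hw => hw.2, ?_, ?_⟩
  · have hcl : IsClosed (⋃ w ∈ {w : List (Fin (m + 3)) | w.length = k ∧ x ∉ Set.range (fw w)},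
        Set.range (fw w : WX m → WX m)) :=
      ((finite_words k).subset fun w hw => hw.1).isClosed_biUnion fun w _ => isClosed_range_fw w
    refine Filter.mem_of_superset (hcl.isOpen_compl.mem_nhds ?_) ?_
    · simp only [Set.mem_compl_iff, Set.mem_iUnion, not_exists]
      intro w hw hx
      exact hw.2 hx
    · intro y hy
      obtain ⟨w, hw, z, hz⟩ := fw_surj k y
      simp only [Set.mem_iUnion]
      refine ⟨w, ⟨hw, ?_⟩, z, hz.symm⟩
      by_contra hx
      apply hy
      simp only [Set.mem_iUnion]
      exact ⟨w, ⟨hw, hx⟩, z, hz.symm⟩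
  · refine (Set.iUnion₂_subset fun w hw => ?_).trans hVU
    exact hk k le_rfl w hw.1 ⟨x, rfl, hw.2⟩

instance : LocallyConnectedSpace (WX m) := by
  rw [locallyConnectedSpace_iff_connected_subsets]
  intro x U hU
  obtain ⟨S, -, hx, hS, hSU⟩ := cell_nhds x hU
  refine ⟨_, hS, ?_, hSU⟩
  rw [← Set.sUnion_image]
  refine isPreconnected_sUnion x _ ?_ ?_
  · rintro _ ⟨w, hw, rfl⟩; exact hx w hw
  · rintro _ ⟨w, hw, rfl⟩; exact isPreconnected_range_fw w

instance : SecondCountableTopology (WX m) := by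
  have hb : TopologicalSpace.IsTopologicalBasis
      (Set.range fun S : Finset (List (Fin (m + 3))) =>
        interior (⋃ w ∈ S, Set.range (fw w : WX m → WX m))) := by
    refine TopologicalSpace.isTopologicalBasis_of_isOpen_of_nhds ?_ ?_
    · rintro _ ⟨S, rfl⟩
      exact isOpen_interior
    · intro x U hx hU
      obtain ⟨S, hSf, -, hS, hSU⟩ := cell_nhds x (hU.mem_nhds hx)
      refine ⟨_, ⟨hSf.toFinset, rfl⟩, ?_, ?_⟩
      · rw [mem_interior_iff_mem_nhds]; simpa using hS
      · refine interior_subset.trans ?_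
        simpa using hSU
  exact hb.secondCountableTopology (Set.countable_range _)

theorem metrizable : TopologicalSpace.MetrizableSpace (WX m) := inferInstance

/-! Branches at the centre. -/

/-- The branch at the centre. -/
def brn (i : Fin (m + 3)) : Set (WX m) := f i '' {a}ᶜ

theorem brn_eq (i : Fin (m + 3)) : (brn i : Set (WX m)) = (⋃ j ∈ {j | j ≠ i}, Set.range (f j))ᶜ := by
  ext x
  obtain ⟨l, y, rfl⟩ := f_surj x
  simp only [brn, Set.mem_image, Set.mem_compl_iff, Set.mem_singleton_iff, Set.mem_iUnion,
    not_exists]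
  constructor
  · rintro ⟨z, hz, h⟩ j hj ⟨u, hu⟩
    rw [← h] at hu
    rw [f_eq_of_ne hj] at hu
    exact hz hu.2
  · intro h
    have hl : l = i := by
      by_contra hl
      exact h l hl ⟨y, rfl⟩
    subst hl
    refine ⟨y, ?_, rfl⟩
    rintro rfl
    obtain ⟨j, hj⟩ := exists_ne l
    exact h j hj ⟨a, f_a _ _⟩

theorem isOpen_brn (i : Fin (m + 3)) : IsOpen (brn i : Set (WX m)) := by
  rw [brn_eq, isOpen_compl_iff]
  exact (Set.toFinite _).isClosed_biUnion fun j _ => isClosed_range_f j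

theorem f_mem_brn {i j : Fin (m + 3)} {x : WX m} : f i x ∈ (brn j : Set (WX m)) ↔ i = j ∧ x ≠ a := by
  constructor
  · rintro ⟨y, hy, h⟩
    by_cases hij : i = j
    · subst hij
      rw [f_inj] at h
      subst h
      exact ⟨rfl, hy⟩
    · rw [f_eq_of_ne (Ne.symm hij)] at h
      exact absurd h.1 hy
  · rintro ⟨rfl, hx⟩
    exact ⟨x, hx, rfl⟩

theorem c_not_mem_brn {j : Fin (m + 3)} : c ∉ (brn j : Set (WX m)) := by
  unfold c
  rw [f_mem_brn]; simp

theorem mem_brn_of_ne_c {x : WX m} (hx : x ≠ c) : ∃ i, x ∈ brn i := by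
  obtain ⟨i, y, rfl⟩ := f_surj x
  exact ⟨i, f_mem_brn.2 ⟨rfl, fun h => hx (f_eq_c.2 h)⟩⟩

theorem mem_brn_unique {x : WX m} {i j : Fin (m + 3)} (hi : x ∈ brn i) (hj : x ∈ brn j) : i = j := by
  obtain ⟨k, y, rfl⟩ := f_surj x
  rw [f_mem_brn] at hi hj
  rw [← hi.1, hj.1]

theorem preconn_subset_brn {C : Set (WX m)} (hC : IsPreconnected C) (hc : c ∉ C) {x : WX m}
    (hx : x ∈ C) {i : Fin (m + 3)} (hi : x ∈ brn i) : C ⊆ brn i := by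
  refine hC.subset_left_of_subset_union (isOpen_brn i)
    (v := ⋃ j ∈ {j | j ≠ i}, brn j) (isOpen_biUnion fun j _ => isOpen_brn j) ?_ ?_ ⟨x, hx, hi⟩
  · rw [Set.disjoint_left]
    intro y hy hy'
    simp only [Set.mem_iUnion] at hy'
    obtain ⟨j, hj, hy'⟩ := hy'
    exact hj (mem_brn_unique hy' hy)
  · intro y hy
    obtain ⟨j, hj⟩ := mem_brn_of_ne_c (x := y) (fun h => hc (h ▸ hy))
    by_cases hij : j = i
    · subst hij; exact Or.inl hj
    · right
      simp only [Set.mem_iUnion]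
      exact ⟨j, hij, hj⟩

/-! Retractions. -/

theorem exists_retr (l : Fin (m + 3)) : ∃ r : WX m → WX m, Continuous r ∧
    (∀ x, r (f l x) = x) ∧ ∀ i x, i ≠ l → r (f i x) = a := by
  classical
  obtain ⟨r, hr, h⟩ := exists_glue (m := m) (fun i x => if i = l then x else a)
    (fun i => by
      by_cases hi : i = l
      · simp only [hi, if_true]; exact continuous_id
      · simp only [hi, if_false]; exact continuous_const) a (fun i => by simp)
  refine ⟨r, hr, fun x => by rw [h]; simp, fun i x hi => by rw [h]; simp [hi]⟩

theorem exists_retr_word (w : List (Fin (m + 3))) : ∃ r : WX m → WX m, Continuous r ∧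
    (∀ x, r (fw w x) = x) ∧ ∀ y, r y = c → y = fw w c := by
  induction w with
  | nil => exact ⟨id, continuous_id, fun x => rfl, fun y h => h⟩
  | cons i w ih =>
    obtain ⟨r, hr, h1, h2⟩ := ih
    obtain ⟨s, hs, g1, g2⟩ := exists_retr (m := m) i
    refine ⟨r ∘ s, hr.comp hs, fun x => ?_, fun y hy => ?_⟩
    · simp [g1, h1]
    · have := h2 _ hy
      obtain ⟨j, z, rfl⟩ := f_surj y
      by_cases hj : j = i
      · subst hj
        rw [g1] at this
        rw [this]; rfl
      · rw [g2 j z hj] at this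
        exact absurd this.symm (fw_c_ne_a w)

theorem split_words (w : List (Fin (m + 3))) (x y : WX m) (hx : x ∈ Set.range (fw w))
    (hy : y ∉ Set.range (fw w)) : ∃ v i j x' y', i ≠ j ∧ x = fw v (f i x') ∧ y = fw v (f j y') := by
  induction w generalizing x y with
  | nil => exact absurd ⟨y, rfl⟩ hy
  | cons i w ih =>
    obtain ⟨x', rfl⟩ := hx
    obtain ⟨j, y', rfl⟩ := f_surj y
    by_cases hij : i = j
    · subst hij
      obtain ⟨v, i', j', x'', y'', h, h1, h2⟩ := ih (fw w x') y' ⟨x', rfl⟩ (by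
        rintro ⟨z, rfl⟩
        exact hy ⟨z, rfl⟩)
      exact ⟨i :: v, i', j', x'', y'', h, by rw [fw_cons, h1, fw_cons], by rw [fw_cons, h2]⟩
    · exact ⟨[], i, j, fw w x', y', hij, rfl, rfl⟩

theorem exists_sep {x y : WX m} (hxy : x ≠ y) (hx : ¬ Br x) (hy : ¬ Br y) :
    ∃ p U V, Br p ∧ IsOpen U ∧ IsOpen V ∧ Disjoint U V ∧ (∀ z, z ≠ p → z ∈ U ∪ V) ∧
      x ∈ U ∧ y ∈ V ∧ p ≠ x ∧ p ≠ y := by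
  obtain ⟨k, hk⟩ := shrink (isCompact_singleton (x := x))
    (isOpen_compl_singleton (x := y)) (by simpa using hxy.symm)
  obtain ⟨w, hw, x', hx'⟩ := fw_surj k x
  obtain ⟨v, i, j, x', y', hij, rfl, rfl⟩ := split_words w x y ⟨x', hx'.symm⟩ (fun hyw =>
    (hk k le_rfl w hw ⟨x, rfl, x', hx'.symm⟩ hyw) rfl)
  obtain ⟨r, hr, h1, h2⟩ := exists_retr_word v
  refine ⟨fw v c, r ⁻¹' (brn i), r ⁻¹' (Set.range (f i))ᶜ, ⟨v, rfl⟩, (isOpen_brn i).preimage hr,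
    (isClosed_range_f i).isOpen_compl.preimage hr, ?_, ?_, ?_, ?_, ?_, ?_⟩
  · rw [Set.disjoint_left]
    rintro z ⟨u, hu, hz⟩ hz'
    exact hz' ⟨u, hz⟩
  · intro z hz
    by_cases hzi : r z ∈ Set.range (f i)
    · obtain ⟨u, hu⟩ := hzi
      left
      rw [Set.mem_preimage, ← hu, f_mem_brn]
      refine ⟨rfl, ?_⟩
      rintro rfl
      rw [f_a_eq] at hu
      exact hz (h2 _ hu.symm)
    · exact Or.inr hzi
  · rw [Set.mem_preimage, h1, f_mem_brn]
    refine ⟨rfl, ?_⟩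
    rintro rfl
    exact hx ⟨v, by rw [f_a_eq]⟩
  · rw [Set.mem_preimage, h1]
    rintro ⟨u, hu⟩
    rw [f_eq_of_ne hij] at hu
    apply hy
    rw [hu.2, f_a_eq]
    exact ⟨v, rfl⟩
  · rintro h; exact hx ⟨v, h.symm⟩
  · rintro h; exact hy ⟨v, h.symm⟩

theorem countable_br : {x : WX m | Br x}.Countable := by
  have : {x : WX m | Br x} = Set.range fun w : List (Fin (m + 3)) => fw w c := by
    ext x
    exact ⟨fun ⟨w, h⟩ => ⟨w, h.symm⟩, fun ⟨w, h⟩ => ⟨w, h.symm⟩⟩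
  rw [this]
  exact Set.countable_range _

theorem exists_cut {S : Set (WX m)} (hS : IsPreconnected S) (hnt : S.Nontrivial) :
    ∃ p ∈ S, Br p ∧ ¬ IsPreconnected (S \ {p}) := by
  have hunc : ¬ S.Countable := by
    intro hc
    let _ := TopologicalSpace.metrizableSpaceMetric (WX m)
    have := hc.isTotallyDisconnected S subset_rfl hS
    exact Set.not_subsingleton_iff.2 hnt this
  have hnt' : (S \ {x | Br x}).Nontrivial := by
    rw [← Set.not_subsingleton_iff]
    intro h
    apply hunc
    refine (h.countable.union countable_br).mono fun x hx => ?_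
    by_cases hb : Br x
    · exact Or.inr hb
    · exact Or.inl ⟨hx, hb⟩
  obtain ⟨x, ⟨hxS, hxb⟩, y, ⟨hyS, hyb⟩, hxy⟩ := hnt'
  obtain ⟨p, U, V, hp, hU, hV, hUV, hcov, hxU, hyV, hpx, hpy⟩ := exists_sep hxy hxb hyb
  have hnp : ¬ IsPreconnected (S \ {p}) := by
    intro h
    obtain ⟨z, -, hz1, hz2⟩ := h U V hU hV (fun z hz => hcov z hz.2)
      ⟨x, ⟨hxS, fun h => hpx h.symm⟩, hxU⟩ ⟨y, ⟨hyS, fun h => hpy h.symm⟩, hyV⟩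
    exact Set.disjoint_left.1 hUV hz1 hz2
  refine ⟨p, ?_, hp, hnp⟩
  by_contra hpS
  rw [Set.sdiff_singleton_eq_self hpS] at hnp
  exact hnp hS

/-! No circle. -/

theorem circle_compl (z : Circle) : IsPreconnected ({z}ᶜ : Set Circle) := by
  have : ({z}ᶜ : Set Circle) = (fun t : ℝ => z * Circle.exp (Real.pi + t)) ''
      Set.Ioo (-Real.pi) Real.pi := by
    ext w
    constructor
    · intro hw
      set u : Circle := w * z⁻¹ * (Circle.exp Real.pi)⁻¹ with hu
      have hw' : w = z * Circle.exp (Real.pi + Complex.arg u) := by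
        rw [Circle.exp_add, Circle.exp_arg, hu]
        have : z * (Circle.exp Real.pi * (w * z⁻¹ * (Circle.exp Real.pi)⁻¹)) =
          w * (z * z⁻¹) * (Circle.exp Real.pi * (Circle.exp Real.pi)⁻¹) := by ac_rfl
        rw [this, mul_inv_cancel, mul_inv_cancel, mul_one, mul_one]
      refine ⟨Complex.arg u, ⟨Complex.neg_pi_lt_arg _, lt_of_le_of_ne (Complex.arg_le_pi _) ?_⟩,
        hw'.symm⟩
      intro h
      apply hw
      rw [Set.mem_singleton_iff, hw', h]
      have : Real.pi + Real.pi = 2 * Real.pi := by ring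
      rw [this, Circle.exp_two_pi, mul_one]
    · rintro ⟨t, ⟨h1, h2⟩, rfl⟩ h
      simp only [Set.mem_singleton_iff, mul_eq_left] at h
      have h3 : Circle.exp t = Circle.exp Real.pi := by
        have h4 : Circle.exp (Real.pi + Real.pi) = 1 := by
          have : Real.pi + Real.pi = 2 * Real.pi := by ring
          rw [this, Circle.exp_two_pi]
        rw [Circle.exp_add] at h h4
        exact mul_left_cancel (h.trans h4.symm)
      have h5 := congrArg (fun w : Circle => Complex.arg w) h3
      rw [Circle.arg_exp h1 h2.le, Circle.arg_exp (by linarith [Real.pi_pos]) le_rfl] at h5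
      linarith
  rw [this]
  refine isPreconnected_Ioo.image _ (Continuous.continuousOn ?_)
  fun_prop

theorem circle_univ : IsPreconnected (Set.univ : Set Circle) := by
  have : (Set.univ : Set Circle) = Set.range Circle.exp := by
    ext z; simp only [Set.mem_univ, true_iff]
    exact ⟨_, Circle.exp_arg z⟩
  rw [this]
  exact isPreconnected_range Circle.exp.continuous

theorem no_circle (S : Set (WX m)) : IsEmpty (S ≃ₜ Circle) := by
  refine ⟨fun e => ?_⟩
  have hcont : Continuous fun z : Circle => ((e.symm z : S) : WX m) := by fun_prop
  have hS : IsPreconnected S := by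
    have : S = (fun z : Circle => ((e.symm z : S) : WX m)) '' Set.univ := by
      ext x
      constructor
      · intro hx
        exact ⟨e ⟨x, hx⟩, trivial, by simp⟩
      · rintro ⟨z, -, rfl⟩; exact (e.symm z).2
    rw [this]
    exact circle_univ.image _ hcont.continuousOn
  have hnt : S.Nontrivial := by
    refine ⟨_, (e.symm 1).2, _, (e.symm (Circle.exp Real.pi)).2, ?_⟩
    intro h
    have h' := e.symm.injective (Subtype.ext h)
    have h5 := congrArg (fun w : Circle => Complex.arg w) h'
    rw [Circle.arg_exp (by linarith [Real.pi_pos]) le_rfl] at h5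
    simp at h5
    exact Real.pi_ne_zero h5.symm
  obtain ⟨p, hpS, -, hp⟩ := exists_cut hS hnt
  apply hp
  have : S \ {p} = (fun z : Circle => ((e.symm z : S) : WX m)) '' {e ⟨p, hpS⟩}ᶜ := by
    ext x
    constructor
    · rintro ⟨hx, hxp⟩
      refine ⟨e ⟨x, hx⟩, fun h => hxp ?_, by simp⟩
      have := e.injective h
      simpa using this
    · rintro ⟨z, hz, rfl⟩
      refine ⟨(e.symm z).2, fun h => hz ?_⟩
      have : e.symm z = ⟨p, hpS⟩ := Subtype.ext h
      rw [← this]; simp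
  rw [this]
  exact (circle_compl _).image _ hcont.continuousOn

theorem arc_br (S : Set (WX m)) (e : S ≃ₜ unitInterval) : ∃ p ∈ S, Br p := by
  have hcont : Continuous fun z : unitInterval => ((e.symm z : S) : WX m) := by fun_prop
  have hS : IsPreconnected S := by
    have : S = (fun z : unitInterval => ((e.symm z : S) : WX m)) '' Set.univ := by
      ext x
      constructor
      · intro hx
        exact ⟨e ⟨x, hx⟩, trivial, by simp⟩
      · rintro ⟨z, -, rfl⟩; exact (e.symm z).2
    rw [this]
    exact isPreconnected_univ.image _ hcont.continuousOn
  have hnt : S.Nontrivial := by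
    refine ⟨_, (e.symm 0).2, _, (e.symm 1).2, ?_⟩
    intro h
    have h' := e.symm.injective (Subtype.ext h)
    exact zero_ne_one h'
  obtain ⟨p, hpS, hb, -⟩ := exists_cut hS hnt
  exact ⟨p, hpS, hb⟩

end Waz

namespace Waz

variable {m : ℕ}

theorem fw_eq_b {v : List (Fin (m + 3))} {z : WX m} (h : fw v z = b) : z = b := by
  induction v with
  | nil => exact h
  | cons i v ih => exact ih (f_eq_b.1 h).2

theorem fw_eq_a {v : List (Fin (m + 3))} {z : WX m} (h : fw v z = a) : z = a ∨ z = b := by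
  cases v with
  | nil => exact Or.inl h
  | cons i v => exact Or.inr (fw_eq_b (f_eq_a.1 h).2)

theorem outside (v : List (Fin (m + 3))) (x : WX m) (hx : x ∉ Set.range (fw v)) :
    ∃ C : Set (WX m), IsPreconnected C ∧ x ∈ C ∧ (fw v a ∈ C ∨ fw v b ∈ C) ∧
      ∀ y, fw v y ∈ C → (y = a ∨ y = b) ∧ Br (fw v y) := by
  induction v generalizing x with
  | nil => exact absurd ⟨x, rfl⟩ hx
  | cons i v ih =>
    obtain ⟨j, y, rfl⟩ := f_surj x
    by_cases hij : j = i
    · subst hij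
      obtain ⟨C, hC, hyC, hend, hout⟩ := ih y (by
        rintro ⟨z, rfl⟩
        exact hx ⟨z, rfl⟩)
      refine ⟨f j '' C, hC.image _ (continuous_f j).continuousOn, ⟨y, hyC, rfl⟩, ?_, ?_⟩
      · rcases hend with h | h
        · exact Or.inl ⟨_, h, rfl⟩
        · exact Or.inr ⟨_, h, rfl⟩
      · rintro z ⟨u, hu, huz⟩
        rw [fw_cons, f_inj] at huz
        subst huz
        obtain ⟨h1, h2⟩ := hout z hu
        exact ⟨h1, h2.f j⟩
    · by_cases ha : a ∈ Set.range (fw v : WX m → WX m)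
      · obtain ⟨z, hz⟩ := ha
        refine ⟨Set.range (f j), isPreconnected_range_f j, ⟨y, rfl⟩, ?_, ?_⟩
        · rcases fw_eq_a hz with rfl | rfl
          · left; exact ⟨a, by rw [fw_cons, hz]; exact f_a _ _⟩
          · right; exact ⟨a, by rw [fw_cons, hz]; exact f_a _ _⟩
        · rintro u ⟨t, ht⟩
          rw [fw_cons, f_eq_of_ne hij] at ht
          refine ⟨fw_eq_a ht.2, ?_⟩
          rw [fw_cons, ht.2, f_a_eq]
          exact br_c
      · obtain ⟨C, hC, hyC, hend, hout⟩ := ih a ha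
        refine ⟨Set.range (f j) ∪ f i '' C, ?_, Or.inl ⟨y, rfl⟩, ?_, ?_⟩
        · exact (isPreconnected_range_f j).union c ⟨a, f_a_eq j⟩ ⟨a, hyC, f_a_eq i⟩
            (hC.image _ (continuous_f i).continuousOn)
        · rcases hend with h | h
          · exact Or.inl (Or.inr ⟨_, h, rfl⟩)
          · exact Or.inr (Or.inr ⟨_, h, rfl⟩)
        · rintro z (⟨u, hu⟩ | ⟨u, hu, huz⟩)
          · rw [fw_cons, f_eq_of_ne hij] at hu
            exact absurd ⟨z, hu.2⟩ ha
          · rw [fw_cons, f_inj] at huz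
            subst huz
            obtain ⟨h1, h2⟩ := hout z hu
            exact ⟨h1, h2.f i⟩

theorem exists_small_cell (p : WX m) (F : Set (WX m)) (hF : F.Finite) (hp : p ∉ F) :
    ∃ v : List (Fin (m + 3)), p ∈ Set.range (fw v) ∧ ∀ x ∈ F, x ∉ Set.range (fw v) := by
  obtain ⟨k, hk⟩ := shrink (isCompact_singleton (x := p)) hF.isClosed.isOpen_compl
    (by simpa using hp)
  obtain ⟨v, hv, y, hy⟩ := fw_surj k p
  refine ⟨v, ⟨y, hy.symm⟩, fun x hx hxv => ?_⟩
  exact hk k le_rfl v hv ⟨p, rfl, y, hy.symm⟩ hxv hx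

theorem preconn_compl_a : IsPreconnected ({a}ᶜ : Set (WX m)) := by
  refine isPreconnected_of_forall_pair fun x hx y hy => ?_
  obtain ⟨v, ⟨z, hz⟩, hv⟩ := exists_small_cell (m := m) a {x, y} (Set.toFinite _) (by
    rintro (h | h)
    · exact hx h.symm
    · exact hy h.symm)
  have hz' : z = b := by
    cases v with
    | nil => exact absurd ⟨x, rfl⟩ (hv x (by simp))
    | cons i v => exact fw_eq_b (f_eq_a.1 hz).2
  subst hz'
  have key : ∀ x ∉ Set.range (fw v : WX m → WX m), ∃ C : Set (WX m), IsPreconnected C ∧ x ∈ C ∧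
      fw v a ∈ C ∧ C ⊆ {a}ᶜ := by
    intro x hx
    obtain ⟨C, hC, hxC, hend, hout⟩ := outside v x hx
    have h1 : a ∉ C := by
      intro h
      rw [← hz] at h
      have := (hout _ h).2
      rw [hz] at this
      exact not_br_a this
    refine ⟨C, hC, hxC, ?_, fun w hw hwa => h1 (hwa ▸ hw)⟩
    rcases hend with h | h
    · exact h
    · rw [hz] at h
      exact absurd h h1
  obtain ⟨C, hC, hxC, haC, hCs⟩ := key x (hv x (by simp))
  obtain ⟨D, hD, hyD, haD, hDs⟩ := key y (hv y (by simp))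
  exact ⟨C ∪ D, Set.union_subset hCs hDs, Or.inl hxC, Or.inr hyD, hC.union _ haC haD hD⟩

theorem brn_preconn (i : Fin (m + 3)) : IsPreconnected (brn i : Set (WX m)) :=
  preconn_compl_a.image _ (continuous_f i).continuousOn

theorem comp_c {x : WX m} {i : Fin (m + 3)} (hx : x ∈ brn i) :
    connectedComponentIn {c}ᶜ x = brn i := by
  have hsub : (brn i : Set (WX m)) ⊆ {c}ᶜ := fun y hy h => c_not_mem_brn (h ▸ hy)
  apply Set.Subset.antisymm
  · refine preconn_subset_brn isPreconnected_connectedComponentIn ?_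
      (mem_connectedComponentIn (hsub hx)) hx
    exact fun h => connectedComponentIn_subset _ _ h rfl
  · exact (brn_preconn i).subset_connectedComponentIn hx hsub

theorem brn_nonempty (i : Fin (m + 3)) : (brn i : Set (WX m)).Nonempty :=
  ⟨f i b, f_mem_brn.2 ⟨rfl, a_ne_b.symm⟩⟩

theorem brn_inj : Function.Injective (brn : Fin (m + 3) → Set (WX m)) := by
  intro i j h
  obtain ⟨x, hx⟩ := brn_nonempty i
  exact mem_brn_unique hx (h ▸ hx)

theorem comps_c : setComponents (WX m) {c}ᶜ = Set.range brn := by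
  ext C
  constructor
  · rintro ⟨x, hx, rfl⟩
    obtain ⟨i, hi⟩ := mem_brn_of_ne_c hx
    exact ⟨i, (comp_c hi).symm⟩
  · rintro ⟨i, rfl⟩
    obtain ⟨x, hx⟩ := brn_nonempty i
    exact ⟨x, fun h => c_not_mem_brn (h ▸ hx), (comp_c hx).symm⟩

theorem order_c : ptOrder (WX m) c = m + 3 := by
  unfold ptOrder
  rw [comps_c, ← Set.image_univ, Set.ncard_image_of_injective _ brn_inj]
  simp

theorem comps_homeo (h : WX m ≃ₜ WX m) (p : WX m) :
    setComponents (WX m) {h p}ᶜ = (fun B => h '' B) '' setComponents (WX m) {p}ᶜ := by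
  have himg : h '' {p}ᶜ = {h p}ᶜ := by
    rw [Set.image_compl_eq h.bijective, Set.image_singleton]
  ext C
  constructor
  · rintro ⟨x, hx, rfl⟩
    have hx' : h.symm x ∈ ({p}ᶜ : Set (WX m)) := by
      intro e
      apply hx
      rw [Set.mem_singleton_iff] at e ⊢
      rw [← e]; simp
    refine ⟨_, ⟨h.symm x, hx', rfl⟩, ?_⟩
    have := h.image_connectedComponentIn (s := {p}ᶜ) hx'
    simp only [this, himg, Homeomorph.apply_symm_apply]
  · rintro ⟨_, ⟨x, hx, rfl⟩, rfl⟩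
    refine ⟨h x, ?_, ?_⟩
    · rw [← himg]; exact ⟨x, hx, rfl⟩
    · simp only [h.image_connectedComponentIn (s := {p}ᶜ) hx, himg]

theorem order_homeo (h : WX m ≃ₜ WX m) (p : WX m) :
    ptOrder (WX m) (h p) = ptOrder (WX m) p := by
  unfold ptOrder
  rw [comps_homeo]
  exact Set.ncard_image_of_injective _ h.injective.image_injective

theorem order_not_br {p : WX m} (hp : ¬ Br p) :
    ptOrder (WX m) p = 1 ∨ ptOrder (WX m) p = 2 := by
  have hne : (setComponents (WX m) {p}ᶜ).Nonempty := by
    have : ∃ x : WX m, x ≠ p := ⟨c, fun h => hp (h ▸ br_c)⟩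
    obtain ⟨x, hx⟩ := this
    exact ⟨_, x, hx, rfl⟩
  have hle : (setComponents (WX m) {p}ᶜ).encard ≤ 2 := by
    by_contra hlt
    have h3 : (3 : ℕ∞) ≤ (setComponents (WX m) {p}ᶜ).encard := by
      have := Order.add_one_le_of_lt (not_le.1 hlt)
      norm_num at this
      exact this
    obtain ⟨T, hT, hT3⟩ := Set.exists_subset_encard_eq h3
    obtain ⟨A, B, C, hAB, hAC, hBC, rfl⟩ := Set.encard_eq_three.1 hT3
    obtain ⟨x, hx, rfl⟩ := hT (show A ∈ _ by simp)
    obtain ⟨y, hy, rfl⟩ := hT (show B ∈ _ by simp)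
    obtain ⟨z, hz, rfl⟩ := hT (show C ∈ _ by simp)
    obtain ⟨v, ⟨q, hq⟩, hv⟩ := exists_small_cell p {x, y, z} (Set.toFinite _) (by
      rintro (h | h | h)
      · exact hx h.symm
      · exact hy h.symm
      · exact hz h.symm)
    have key : ∀ x ∉ Set.range (fw v : WX m → WX m),
        connectedComponentIn {p}ᶜ x = connectedComponentIn {p}ᶜ (fw v a) ∨
        connectedComponentIn {p}ᶜ x = connectedComponentIn {p}ᶜ (fw v b) := by
      intro x hx
      obtain ⟨C, hC, hxC, hend, hout⟩ := outside v x hx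
      have hCp : C ⊆ {p}ᶜ := by
        rintro w hw rfl
        rw [← hq] at hw
        apply hp
        rw [← hq]
        exact (hout _ hw).2
      have hsub := hC.subset_connectedComponentIn hxC hCp
      rcases hend with h | h
      · exact Or.inl (connectedComponentIn_eq (hsub h))
      · exact Or.inr (connectedComponentIn_eq (hsub h))
    rcases key x (hv x (by simp)) with h1 | h1 <;> rcases key y (hv y (by simp)) with h2 | h2 <;>
      rcases key z (hv z (by simp)) with h3 | h3 <;>
      simp_all
  have hfin : (setComponents (WX m) {p}ᶜ).Finite :=
    Set.finite_of_encard_le_coe (k := 2) hle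
  unfold ptOrder
  have h1 : 0 < (setComponents (WX m) {p}ᶜ).ncard := (Set.ncard_pos hfin).2 hne
  have h2 : (setComponents (WX m) {p}ᶜ).ncard ≤ 2 := by
    rw [← hfin.cast_ncard_eq] at hle
    exact_mod_cast hle
  omega

end Waz

namespace Waz
variable {m : ℕ}

/-- The homeomorphism group. -/
abbrev HG (m : ℕ) := WX m ≃ₜ WX m

theorem hg_mul (g h : HG m) (x : WX m) : (g * h) x = g (h x) := rfl
theorem hg_one (x : WX m) : (1 : HG m) x = x := rfl
theorem hg_inv_apply (g : HG m) (x : WX m) : g⁻¹ (g x) = x := g.symm_apply_apply x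
theorem hg_apply_inv (g : HG m) (x : WX m) : g (g⁻¹ x) = x := g.apply_symm_apply x
theorem hg_inv_eq {g : HG m} {x y : WX m} (h : g x = y) : g⁻¹ y = x := by
  rw [← h, hg_inv_apply]

theorem hg_ext {g h : HG m} (H : ∀ i x, g (f i x) = h (f i x)) : g = h := by
  refine Homeomorph.ext fun x => ?_
  obtain ⟨i, y, rfl⟩ := f_surj x
  exact H i y

/-- Build a homeomorphism from two mutually inverse maps. -/
def mkH (F F' : WX m → WX m) (hF : Continuous F) (hF' : Continuous F')
    (h1 : ∀ x, F' (F x) = x) (h2 : ∀ x, F (F' x) = x) : HG m where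
  toFun := F
  invFun := F'
  left_inv := h1
  right_inv := h2
  continuous_toFun := hF
  continuous_invFun := hF'

theorem mkH_apply (F F' : WX m → WX m) (hF : Continuous F) (hF' : Continuous F')
    (h1 : ∀ x, F' (F x) = x) (h2 : ∀ x, F (F' x) = x) (x : WX m) :
    mkH F F' hF hF' h1 h2 x = F x := rfl

/-- Permutation map. -/
noncomputable def permMap (σ : Equiv.Perm (Fin (m + 3))) : WX m → WX m :=
  glue (fun i => f (σ i)) (fun _ => continuous_f _) c (fun _ => f_a_eq _)

theorem permMap_f (σ : Equiv.Perm (Fin (m + 3))) (i : Fin (m + 3)) (x : WX m) :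
    permMap σ (f i x) = f (σ i) x := glue_f _ _ _ _ i x

theorem permMap_inv (σ τ : Equiv.Perm (Fin (m + 3))) (h : ∀ i, σ (τ i) = i) (x : WX m) :
    permMap σ (permMap τ x) = x := by
  obtain ⟨i, y, rfl⟩ := f_surj x
  rw [permMap_f, permMap_f, h]

/-- Permutation homeomorphism. -/
noncomputable def perm (σ : Equiv.Perm (Fin (m + 3))) : HG m :=
  mkH (permMap σ) (permMap σ.symm) (continuous_glue _ _ _ _) (continuous_glue _ _ _ _)
    (permMap_inv _ _ (by simp)) (permMap_inv _ _ (by simp))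

theorem perm_f (σ : Equiv.Perm (Fin (m + 3))) (i : Fin (m + 3)) (x : WX m) :
    perm σ (f i x) = f (σ i) x := permMap_f σ i x

theorem perm_c (σ : Equiv.Perm (Fin (m + 3))) : perm σ (c : WX m) = c := by
  conv_lhs => rw [← f_a_eq 0]
  rw [perm_f, f_a_eq]

theorem perm_a {σ : Equiv.Perm (Fin (m + 3))} (h : σ 0 = 0) : perm σ (a : WX m) = a := by
  conv_lhs => rw [← f_zero_b]
  rw [perm_f, h, f_zero_b]

theorem perm_b {σ : Equiv.Perm (Fin (m + 3))} (h : σ 1 = 1) : perm σ (b : WX m) = b := by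
  conv_lhs => rw [← f_one_b]
  rw [perm_f, h, f_one_b]

theorem perm_inv (σ : Equiv.Perm (Fin (m + 3))) : (perm σ)⁻¹ = (perm σ⁻¹ : HG m) := by
  rw [inv_eq_iff_mul_eq_one]
  refine hg_ext fun i x => ?_
  rw [hg_mul, perm_f, perm_f]; simp

/-- The flip. -/
noncomputable def tau : HG m := perm (Equiv.swap 0 1)

theorem tau_tau (x : WX m) : tau (tau x) = x := by
  obtain ⟨i, y, rfl⟩ := f_surj x
  unfold tau
  rw [perm_f, perm_f, Equiv.swap_apply_self]

theorem one_ne_zero' : (1 : Fin (m + 3)) ≠ 0 := by simp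

theorem tau_f0 (x : WX m) : tau (f 0 x) = f 1 x := by
  unfold tau; rw [perm_f, Equiv.swap_apply_left]
theorem tau_f1 (x : WX m) : tau (f 1 x) = f 0 x := by
  unfold tau; rw [perm_f, Equiv.swap_apply_right]
theorem tau_fj {j : Fin (m + 3)} (h0 : j ≠ 0) (h1 : j ≠ 1) (x : WX m) :
    tau (f j x) = f j x := by
  unfold tau; rw [perm_f, Equiv.swap_apply_of_ne_of_ne h0 h1]
theorem tau_c : tau (c : WX m) = c := perm_c _
theorem tau_b : tau (b : WX m) = a := by
  conv_lhs => rw [← f_one_b]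
  rw [tau_f1, f_zero_b]
theorem tau_a : tau (a : WX m) = b := by
  rw [← tau_b, tau_tau]

/-- Inner map for `x0`. -/
noncomputable def Hm : WX m → WX m :=
  glue (fun j => if j = 0 then fun x => f 1 (f 0 (tau x)) else if j = 1 then f 0 else f j)
    (fun j => by
      split_ifs
      · exact (continuous_f 1).comp ((continuous_f 0).comp tau.continuous)
      · exact continuous_f 0
      · exact continuous_f j) c (fun j => by
      split_ifs
      · beta_reduce; rw [tau_a, f_zero_b, f_a_eq]
      · exact f_a_eq _
      · exact f_a_eq _)

theorem continuous_Hm : Continuous (Hm : WX m → WX m) := continuous_glue _ _ _ _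
theorem Hm_0 (x : WX m) : Hm (f 0 x) = f 1 (f 0 (tau x)) := by
  unfold Hm; rw [glue_f]; simp
theorem Hm_1 (x : WX m) : Hm (f 1 x) = f 0 x := by
  unfold Hm; rw [glue_f]; simp
theorem Hm_j {j : Fin (m + 3)} (h0 : j ≠ 0) (h1 : j ≠ 1) (x : WX m) :
    Hm (f j x) = f j x := by
  unfold Hm; rw [glue_f]; simp [h0, h1]
theorem Hm_a : Hm (a : WX m) = f 1 c := by
  conv_lhs => rw [← f_zero_b]
  rw [Hm_0, tau_b, f_a_eq]

/-- The map underlying `x0`. -/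
noncomputable def Fm : WX m → WX m :=
  glue (fun j => if j = 0 then Hm else fun x => f 1 (f j x))
    (fun j => by
      split_ifs
      · exact continuous_Hm
      · exact (continuous_f 1).comp (continuous_f j)) (f 1 c) (fun j => by
      split_ifs
      · exact Hm_a
      · beta_reduce; rw [f_a_eq])
theorem Fm_0 (x : WX m) : Fm (f 0 x) = Hm x := by
  unfold Fm; rw [glue_f]; simp
theorem Fm_j {j : Fin (m + 3)} (h0 : j ≠ 0) (x : WX m) :
    Fm (f j x) = f 1 (f j x) := by
  unfold Fm; rw [glue_f]; simp [h0]

/-- Inner map for the inverse of `x0`. -/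
noncomputable def Hm' : WX m → WX m :=
  glue (fun j => if j = 0 then fun x => f 0 (f 0 (tau x)) else f j)
    (fun j => by
      split_ifs
      · exact (continuous_f 0).comp ((continuous_f 0).comp tau.continuous)
      · exact continuous_f j) c (fun j => by
      split_ifs
      · beta_reduce; rw [tau_a, f_zero_b, f_a_eq]
      · exact f_a_eq _)
theorem continuous_Hm' : Continuous (Hm' : WX m → WX m) := continuous_glue _ _ _ _
theorem Hm'_0 (x : WX m) : Hm' (f 0 x) = f 0 (f 0 (tau x)) := by
  unfold Hm'; rw [glue_f]; simp
theorem Hm'_j {j : Fin (m + 3)} (h0 : j ≠ 0) (x : WX m) :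
    Hm' (f j x) = f j x := by
  unfold Hm'; rw [glue_f]; simp [h0]
theorem Hm'_a : Hm' (a : WX m) = f 0 c := by
  conv_lhs => rw [← f_zero_b]
  rw [Hm'_0, tau_b, f_a_eq]

/-- The map underlying the inverse of `x0`. -/
noncomputable def Fm' : WX m → WX m :=
  glue (fun j => if j = 0 then fun x => f 0 (f 1 x) else if j = 1 then Hm'
      else fun x => f 0 (f j x))
    (fun j => by
      split_ifs
      · exact (continuous_f 0).comp (continuous_f 1)
      · exact continuous_Hm'
      · exact (continuous_f 0).comp (continuous_f j)) (f 0 c) (fun j => by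
      split_ifs
      · beta_reduce; rw [f_a_eq]
      · exact Hm'_a
      · beta_reduce; rw [f_a_eq])
theorem Fm'_0 (x : WX m) : Fm' (f 0 x) = f 0 (f 1 x) := by
  unfold Fm'; rw [glue_f]; simp
theorem Fm'_1 (x : WX m) : Fm' (f 1 x) = Hm' x := by
  unfold Fm'; rw [glue_f]; simp
theorem Fm'_j {j : Fin (m + 3)} (h0 : j ≠ 0) (h1 : j ≠ 1) (x : WX m) :
    Fm' (f j x) = f 0 (f j x) := by
  unfold Fm'; rw [glue_f]; simp [h0, h1]

theorem Fm'_Fm (x : WX m) : Fm' (Fm x) = x := by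
  obtain ⟨i, y, rfl⟩ := f_surj x
  by_cases hi : i = 0
  · subst hi
    obtain ⟨j, z, rfl⟩ := f_surj y
    rw [Fm_0]
    by_cases h0 : j = 0
    · subst h0; rw [Hm_0, Fm'_1, Hm'_0, tau_tau]
    by_cases h1 : j = 1
    · subst h1; rw [Hm_1, Fm'_0]
    · rw [Hm_j h0 h1, Fm'_j h0 h1]
  · rw [Fm_j hi, Fm'_1, Hm'_j hi]

theorem Fm_Fm' (x : WX m) : Fm (Fm' x) = x := by
  obtain ⟨i, y, rfl⟩ := f_surj x
  by_cases hi : i = 0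
  · subst hi
    rw [Fm'_0, Fm_0, Hm_1]
  by_cases h1 : i = 1
  · subst h1
    obtain ⟨j, z, rfl⟩ := f_surj y
    rw [Fm'_1]
    by_cases h0 : j = 0
    · subst h0; rw [Hm'_0, Fm_0, Hm_0, tau_tau]
    · rw [Hm'_j h0, Fm_j h0]
  · rw [Fm'_j hi h1, Fm_0, Hm_j hi h1]

/-- The first Thompson-like generator. -/
noncomputable def x0 : HG m :=
  mkH Fm Fm' (continuous_glue _ _ _ _) (continuous_glue _ _ _ _) Fm'_Fm Fm_Fm'

theorem x0_j {j : Fin (m + 3)} (h0 : j ≠ 0) (x : WX m) : x0 (f j x) = f 1 (f j x) := Fm_j h0 x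
theorem x0_00 (x : WX m) : x0 (f 0 (f 0 x)) = f 1 (f 0 (tau x)) :=
  (Fm_0 _).trans (Hm_0 x)
theorem x0_01 (x : WX m) : x0 (f 0 (f 1 x)) = f 0 x := (Fm_0 _).trans (Hm_1 x)
theorem x0_0j {j : Fin (m + 3)} (h0 : j ≠ 0) (h1 : j ≠ 1) (x : WX m) :
    x0 (f 0 (f j x)) = f j x := (Fm_0 _).trans (Hm_j h0 h1 x)
theorem x0_a : x0 (a : WX m) = a := by
  conv_lhs => rw [← f_zero_b, ← f_one_b]
  rw [x0_01, f_zero_b]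
theorem x0_b : x0 (b : WX m) = b := by
  conv_lhs => rw [← f_one_b]
  rw [x0_j one_ne_zero', f_one_b, f_one_b]

/-- Underlying map of the extension. -/
noncomputable def extMap (i : Fin (m + 3)) (g : HG m) (hg : g a = a) : WX m → WX m :=
  glue (fun j => if j = i then fun x => f i (g x) else f j)
    (fun j => by
      split_ifs
      · exact (continuous_f i).comp g.continuous
      · exact continuous_f j) c (fun j => by
      split_ifs
      · beta_reduce; rw [hg, f_a_eq]
      · exact f_a_eq _)

theorem extMap_same (i : Fin (m + 3)) (g : HG m) (hg : g a = a) (x : WX m) :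
    extMap i g hg (f i x) = f i (g x) := by
  unfold extMap; rw [glue_f]; simp
theorem extMap_ne {i j : Fin (m + 3)} (g : HG m) (hg : g a = a) (h : j ≠ i) (x : WX m) :
    extMap i g hg (f j x) = f j x := by
  unfold extMap; rw [glue_f]; simp [h]

theorem extMap_inv (i : Fin (m + 3)) (g h : HG m) (hg : g a = a) (hh : h a = a)
    (H : ∀ x, g (h x) = x) (x : WX m) : extMap i g hg (extMap i h hh x) = x := by
  obtain ⟨j, y, rfl⟩ := f_surj x
  by_cases hj : j = i
  · subst hj; rw [extMap_same, extMap_same, H]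
  · rw [extMap_ne h hh hj, extMap_ne g hg hj]

open Classical in
/-- Extension of a homeomorphism fixing `a` acting on the `i`-th cell. -/
noncomputable def ext (i : Fin (m + 3)) (g : HG m) : HG m :=
  if hg : g a = a then
    mkH (extMap i g hg) (extMap i g⁻¹ (hg_inv_eq hg))
      (continuous_glue _ _ _ _) (continuous_glue _ _ _ _)
      (extMap_inv _ _ _ _ _ (hg_inv_apply g)) (extMap_inv _ _ _ _ _ (hg_apply_inv g))
  else 1

theorem ext_same (i : Fin (m + 3)) {g : HG m} (hg : g a = a) (x : WX m) :
    ext i g (f i x) = f i (g x) := by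
  unfold ext; rw [dif_pos hg]; exact extMap_same _ _ hg _

theorem ext_ne {i j : Fin (m + 3)} (g : HG m) (h : j ≠ i) (x : WX m) :
    ext i g (f j x) = f j x := by
  unfold ext
  split_ifs with hg
  · exact extMap_ne _ hg h _
  · rfl

theorem ext_mul (i : Fin (m + 3)) {g h : HG m} (hg : g a = a) (hh : h a = a) :
    ext i (g * h) = ext i g * ext i h := by
  have hgh : (g * h) a = a := by rw [hg_mul, hh, hg]
  refine hg_ext fun j x => ?_
  by_cases hj : j = i
  · subst hj; rw [ext_same _ hgh, hg_mul, hg_mul, ext_same _ hh, ext_same _ hg]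
  · rw [ext_ne _ hj, hg_mul, ext_ne _ hj, ext_ne _ hj]

theorem ext_one (i : Fin (m + 3)) : ext i (1 : HG m) = 1 := by
  refine hg_ext fun j x => ?_
  by_cases hj : j = i
  · subst hj; rw [ext_same _ rfl]; rfl
  · rw [ext_ne _ hj]; rfl

theorem ext_inv (i : Fin (m + 3)) {g : HG m} (hg : g a = a) : ext i g⁻¹ = (ext i g)⁻¹ := by
  rw [eq_inv_iff_mul_eq_one, ← ext_mul i (hg_inv_eq hg) hg, inv_mul_cancel, ext_one]

theorem ext_c (i : Fin (m + 3)) {g : HG m} (hg : g a = a) : ext i g c = c := by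
  conv_lhs => rw [← f_a_eq i, ext_same i hg, hg]
  rw [f_a_eq]

theorem ext0_a {g : HG m} (ha : g a = a) (hb : g b = b) : ext 0 g a = a := by
  conv_lhs => rw [← f_zero_b, ext_same 0 ha, hb]
  rw [f_zero_b]

/-- The second Thompson-like generator. -/
noncomputable def x1 : HG m := ext 1 x0

theorem x1_1 (x : WX m) : x1 (f 1 x) = f 1 (x0 x) := ext_same 1 x0_a x
theorem x1_j {j : Fin (m + 3)} (h : j ≠ 1) (x : WX m) : x1 (f j x) = f j x := ext_ne _ h x
theorem x1_a : x1 (a : WX m) = a := by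
  conv_lhs => rw [← f_zero_b, x1_j one_ne_zero'.symm]
  rw [f_zero_b]
theorem x1_b : x1 (b : WX m) = b := by
  conv_lhs => rw [← f_one_b, x1_1, x0_b]
  rw [f_one_b]

/-- Generators relative to a set of fixed letters. -/
def T (A : Set (Fin (m + 3))) : Set (HG m) :=
  {x0, x1} ∪ perm '' {σ | ∀ i ∈ A, σ i = i}

/-- Group generated by `T A`. -/
def K (A : Set (Fin (m + 3))) : Subgroup (HG m) := Subgroup.closure (T A)

theorem x0_mem (A : Set (Fin (m + 3))) : x0 ∈ K A := Subgroup.subset_closure (by simp [T])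
theorem x1_mem (A : Set (Fin (m + 3))) : x1 ∈ K A := Subgroup.subset_closure (by simp [T])
theorem perm_mem {A : Set (Fin (m + 3))} {σ : Equiv.Perm (Fin (m + 3))} (h : ∀ i ∈ A, σ i = i) :
    perm σ ∈ K A := Subgroup.subset_closure (Or.inr ⟨σ, h, rfl⟩)

theorem K_a {A : Set (Fin (m + 3))} (h0 : 0 ∈ A) {g : HG m} (hg : g ∈ K A) : g a = a := by
  refine Subgroup.closure_induction (p := fun g _ => g a = a) ?_ ?_ ?_ ?_ hg
  · rintro x ((rfl | rfl) | ⟨σ, hσ, rfl⟩)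
    · exact x0_a
    · exact x1_a
    · exact perm_a (hσ 0 h0)
  · rfl
  · intro x y _ _ hx hy; rw [hg_mul, hy, hx]
  · intro x _ hx; exact hg_inv_eq hx

theorem K_b {A : Set (Fin (m + 3))} (h0 : 1 ∈ A) {g : HG m} (hg : g ∈ K A) : g b = b := by
  refine Subgroup.closure_induction (p := fun g _ => g b = b) ?_ ?_ ?_ ?_ hg
  · rintro x ((rfl | rfl) | ⟨σ, hσ, rfl⟩)
    · exact x0_b
    · exact x1_b
    · exact perm_b (hσ 1 h0)
  · rfl
  · intro x y _ _ hx hy; rw [hg_mul, hy, hx]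
  · intro x _ hx; exact hg_inv_eq hx

/-- The generating set. -/
def gens (m : ℕ) : Set (HG m) :=
  T ∅ ∪ ext 1 '' T {0} ∪ (fun g => ext 1 (ext 0 g)) '' T {0, 1}

theorem T_finite (A : Set (Fin (m + 3))) : (T A).Finite :=
  (Set.toFinite {x0, x1}).union (Set.Finite.image _ (Set.toFinite _))

/-- The dense finitely generated group. -/
def GG (m : ℕ) : Subgroup (HG m) := Subgroup.closure (gens m)

theorem GG_fg : (GG m).FG := by
  rw [Subgroup.fg_iff]
  exact ⟨gens m, rfl, ((T_finite _).union ((T_finite _).image _)).union ((T_finite _).image _)⟩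

theorem K_le_GG : K ∅ ≤ GG m := Subgroup.closure_mono fun _ h => Or.inl (Or.inl h)

theorem ext1_mem {g : HG m} (hg : g ∈ K {0}) : ext 1 g ∈ GG m := by
  refine Subgroup.closure_induction (p := fun g _ => ext 1 g ∈ GG m) ?_ ?_ ?_ ?_ hg
  · intro x hx
    exact Subgroup.subset_closure (Or.inl (Or.inr ⟨x, hx, rfl⟩))
  · rw [ext_one]; exact one_mem _
  · intro x y hx hy h1 h2
    rw [ext_mul 1 (K_a (Set.mem_singleton 0) hx) (K_a (Set.mem_singleton 0) hy)]
    exact mul_mem h1 h2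
  · intro x hx h1
    rw [ext_inv 1 (K_a (Set.mem_singleton 0) hx)]
    exact inv_mem h1

theorem ext10_mem {g : HG m} (hg : g ∈ K {0, 1}) : ext 1 (ext 0 g) ∈ GG m := by
  have ha : ∀ g : HG m, g ∈ K {0, 1} → g a = a := fun g hg => K_a (by simp) hg
  have hb : ∀ g : HG m, g ∈ K {0, 1} → g b = b := fun g hg => K_b (by simp) hg
  refine Subgroup.closure_induction (p := fun g _ => ext 1 (ext 0 g) ∈ GG m) ?_ ?_ ?_ ?_ hg
  · intro x hx
    exact Subgroup.subset_closure (Or.inr ⟨x, hx, rfl⟩)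
  · rw [ext_one, ext_one]; exact one_mem _
  · intro x y hx hy h1 h2
    rw [ext_mul 0 (ha _ hx) (ha _ hy), ext_mul 1 (ext0_a (ha _ hx) (hb _ hx))
      (ext0_a (ha _ hy) (hb _ hy))]
    exact mul_mem h1 h2
  · intro x hx h1
    rw [ext_inv 0 (ha _ hx), ext_inv 1 (ext0_a (ha _ hx) (hb _ hx))]
    exact inv_mem h1

end Waz

namespace Waz
variable {m : ℕ}

/-- Reducibility of a cell to a standard cell. -/
def Good (A : Set (Fin (m + 3))) (w : List (Fin (m + 3))) : Prop :=
  ∃ k ∈ K A, ∃ u : List (Fin (m + 3)), (u = [] ∨ u = [0] ∨ u = [1] ∨ u = [1, 0]) ∧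
    ∃ e : HG m, (e = 1 ∨ e = tau) ∧ ∀ x, k (fw w x) = fw u (e x)

/-- Admissible words. -/
def Ok (A : Set (Fin (m + 3))) (w : List (Fin (m + 3))) : Prop :=
  A ⊆ {0} ∨ ∀ i ∈ w, i = 0 ∨ i = 1

theorem Good.base {A : Set (Fin (m + 3))} {u : List (Fin (m + 3))}
    (hu : u = [] ∨ u = [0] ∨ u = [1] ∨ u = [1, 0]) : Good A u :=
  ⟨1, one_mem _, u, hu, 1, Or.inl rfl, fun _ => rfl⟩

theorem Good.step {A : Set (Fin (m + 3))} {w w' : List (Fin (m + 3))} (h : Good A w')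
    (g : HG m) (hg : g ∈ K A) (H : ∀ x, g (fw w x) = fw w' x) : Good A w := by
  obtain ⟨k, hk, u, hu, e, he, hx⟩ := h
  exact ⟨k * g, mul_mem hk hg, u, hu, e, he, fun x => by rw [hg_mul, H, hx]⟩

theorem Ok.mono {A : Set (Fin (m + 3))} {w w' : List (Fin (m + 3))} (h : Ok A w)
    (H : (∀ i ∈ w, i = 0 ∨ i = 1) → ∀ i ∈ w', i = 0 ∨ i = 1) : Ok A w' := h.imp_right H

theorem x0_inv_1j {j : Fin (m + 3)} (h : j ≠ 0) (x : WX m) : x0⁻¹ (f 1 (f j x)) = f j x :=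
  hg_inv_eq (x0_j h x)

theorem tau_f (i : Fin (m + 3)) (x : WX m) : tau (f i x) = f (Equiv.swap 0 1 i) x := perm_f _ _ _

theorem swap01 {i : Fin (m + 3)} (h : i = 0 ∨ i = 1) :
    Equiv.swap 0 1 i = 0 ∨ Equiv.swap 0 1 i = 1 := by
  rcases h with rfl | rfl
  · right; simp
  · left; simp

theorem red (A : Set (Fin (m + 3))) : ∀ (N : ℕ) (w : List (Fin (m + 3))), w.length = N → Ok A w →
    Good A w := by
  intro N
  induction N using Nat.strong_induction_on with
  | _ N ih =>
  have ih' : ∀ w : List (Fin (m + 3)), w.length < N → Ok A w → Good A w :=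
    fun w h1 h2 => ih _ h1 w rfl h2
  have h1 : ∀ w : List (Fin (m + 3)), (1 :: w).length = N → Ok A (1 :: w) → Good A (1 :: w) := by
    intro w hw hok
    rcases w with _ | ⟨j, w⟩
    · exact Good.base (by simp)
    simp only [List.length_cons] at hw
    by_cases hj : j = 0
    swap
    · refine (ih' (j :: w) (by simp; omega) (hok.mono fun h i hi => h i (by simp_all))).step x0⁻¹
        (inv_mem (x0_mem _)) fun x => ?_
      simp only [fw_cons]
      rw [x0_inv_1j hj]
    subst hj
    rcases w with _ | ⟨j, w⟩
    · exact Good.base (by simp)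
    simp only [List.length_cons] at hw
    by_cases hj : j = 0
    swap
    · by_cases hj1 : j = 1
      · subst hj1
        refine (ih' (1 :: 0 :: w) (by simp; omega)
          (hok.mono fun h i hi => h i (by simp_all <;> tauto))).step x1
          (x1_mem _) fun x => ?_
        simp only [fw_cons]
        rw [x1_1, x0_01]
      · refine (ih' (1 :: j :: w) (by simp; omega)
          (hok.mono fun h i hi => h i (by simp_all <;> tauto))).step x1
          (x1_mem _) fun x => ?_
        simp only [fw_cons]
        rw [x1_1, x0_0j hj hj1]
    subst hj
    have key : ∀ y : WX m, (x0⁻¹ * x1 : HG m) (f 1 (f 0 (f 0 y))) = f 1 (f 0 (tau y)) := by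
      intro y
      rw [hg_mul, x1_1, x0_00, x0_inv_1j one_ne_zero']
    rcases w with _ | ⟨i, w⟩
    · exact ⟨x0⁻¹ * x1, mul_mem (inv_mem (x0_mem _)) (x1_mem _), [1, 0], by simp, tau, Or.inr rfl,
        fun x => key x⟩
    · simp only [List.length_cons] at hw
      refine (ih' (1 :: 0 :: Equiv.swap 0 1 i :: w) (by simp; omega) (hok.mono fun h j hj => ?_)).step
        (x0⁻¹ * x1) (mul_mem (inv_mem (x0_mem _)) (x1_mem _)) fun x => ?_
      · simp only [List.mem_cons] at hj
        rcases hj with rfl | rfl | rfl | hj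
        · simp
        · simp
        · exact swap01 (h i (by simp))
        · exact h j (by simp [hj])
      · simp only [fw_cons]
        rw [key, tau_f]
  intro w hw hok
  rcases w with _ | ⟨j, w⟩
  · exact Good.base (by simp)
  by_cases hj1 : j = 1
  · subst hj1; exact h1 w hw hok
  by_cases hj0 : j = 0
  swap
  · have hA : A ⊆ {0} := hok.resolve_right fun h => by
      rcases h j (by simp) with h | h <;> contradiction
    refine (h1 w hw (Or.inl hA)).step (perm (Equiv.swap 1 j)) (perm_mem fun i hi => ?_) fun x => ?_
    · have := hA hi
      rw [Set.mem_singleton_iff] at this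
      subst this
      exact Equiv.swap_apply_of_ne_of_ne one_ne_zero'.symm (Ne.symm hj0)
    · simp only [fw_cons]
      rw [perm_f, Equiv.swap_apply_right]
  subst hj0
  rcases w with _ | ⟨j, w⟩
  · exact Good.base (by simp)
  simp only [List.length_cons] at hw
  by_cases hj : j = 0
  swap
  · by_cases hj1 : j = 1
    · subst hj1
      refine (ih' (0 :: w) (by simp; omega)
        (hok.mono fun h i hi => h i (by simp_all <;> tauto))).step x0
        (x0_mem _) fun x => ?_
      simp only [fw_cons]
      rw [x0_01]
    · refine (ih' (j :: w) (by simp; omega)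
        (hok.mono fun h i hi => h i (by simp_all))).step x0
        (x0_mem _) fun x => ?_
      simp only [fw_cons]
      rw [x0_0j hj hj1]
  subst hj
  rcases w with _ | ⟨i, w⟩
  · exact ⟨x0, x0_mem _, [1, 0], by simp, tau, Or.inr rfl, fun x => x0_00 x⟩
  · simp only [List.length_cons] at hw
    refine (h1 (0 :: Equiv.swap 0 1 i :: w) (by simp; omega) (hok.mono fun h j hj => ?_)).step
      x0 (x0_mem _) fun x => ?_
    · simp only [List.mem_cons] at hj
      rcases hj with rfl | rfl | rfl | hj
      · simp
      · simp
      · exact swap01 (h i (by simp))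
      · exact h j (by simp [hj])
    · simp only [fw_cons]
      rw [x0_00, tau_f]

theorem trans_c {A : Set (Fin (m + 3))} {w : List (Fin (m + 3))} (h : Ok A w) :
    ∃ g ∈ K A, g (fw w c) = c := by
  obtain ⟨k, hk, u, hu, e, he, hx⟩ := red A _ w rfl h
  have hec : e c = c := by
    rcases he with rfl | rfl
    · rfl
    · exact tau_c
  have e0 : x0 (f 0 c : WX m) = c := by
    conv_lhs => rw [← f_a_eq 1, x0_01]
    exact f_a_eq 0
  have e1 : x0⁻¹ (f 1 c : WX m) = c := by
    conv_lhs => rw [← f_a_eq 1, x0_inv_1j one_ne_zero']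
    exact f_a_eq 1
  rcases hu with rfl | rfl | rfl | rfl
  · exact ⟨k, hk, by rw [hx, hec]; rfl⟩
  · refine ⟨x0 * k, mul_mem (x0_mem _) hk, ?_⟩
    rw [hg_mul, hx, hec]; exact e0
  · refine ⟨x0⁻¹ * k, mul_mem (inv_mem (x0_mem _)) hk, ?_⟩
    rw [hg_mul, hx, hec]; exact e1
  · refine ⟨x0⁻¹ * x1 * k, mul_mem (mul_mem (inv_mem (x0_mem _)) (x1_mem _)) hk, ?_⟩
    rw [hg_mul, hx, hec, hg_mul]
    simp only [fw_cons, fw_nil]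
    rw [x1_1, e0, e1]

theorem order_br {p : WX m} (hp : Br p) : ptOrder (WX m) p = m + 3 := by
  obtain ⟨w, rfl⟩ := hp
  obtain ⟨g, -, hg⟩ := trans_c (A := ∅) (w := w) (Or.inl (Set.empty_subset _))
  rw [← order_homeo g, hg, order_c]

theorem br_iff {p : WX m} : Br p ↔ ptOrder (WX m) p = m + 3 := by
  refine ⟨order_br, fun h => ?_⟩
  by_contra hp
  have := order_not_br hp
  omega

theorem br_homeo (h : HG m) (p : WX m) : Br (h p) ↔ Br p := by
  rw [br_iff, br_iff, order_homeo]

theorem wazewski : IsWazewskiDendrite (m + 3) (WX m) := by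
  refine ⟨⟨inferInstance, inferInstance, inferInstance, inferInstance, metrizable, no_circle⟩,
    fun p => ?_, fun A hA => ?_⟩
  · by_cases hp : Br p
    · exact Or.inr (Or.inr (order_br hp))
    · rcases order_not_br hp with h | h
      · exact Or.inl h
      · exact Or.inr (Or.inl h)
  · obtain ⟨e⟩ := hA
    obtain ⟨p, hp, hb⟩ := arc_br A e
    exact ⟨p, hp, order_br hb⟩

/-- Every nontrivial cell is `GG`-equivalent to a standard one. -/
theorem cell {w : List (Fin (m + 3))} (hw : w ≠ []) : ∃ k ∈ GG m,
    (∀ x, k (fw w x) = f 1 x) ∨ (∀ x, k (fw w x) = f 1 (f 0 x)) ∨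
    (∀ x, k (fw w x) = f 1 (f 0 (tau x))) := by
  obtain ⟨k, hk, u, hu, e, he, hx⟩ := red ∅ _ w rfl (Or.inl (Set.empty_subset _))
  have hbr : Br (fw w (a : WX m)) := by
    rcases List.eq_nil_or_concat w with h | ⟨v, i, rfl⟩
    · contradiction
    · rw [List.concat_eq_append, fw_append]
      exact ⟨v, by simp [f_a_eq]⟩
  have hbr' : Br (fw u (e a)) := by
    rw [← hx, br_homeo]; exact hbr
  have hkG := K_le_GG hk
  rcases hu with rfl | rfl | rfl | rfl
  · exfalso
    rcases he with rfl | rfl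
    · exact not_br_a hbr'
    · rw [tau_a] at hbr'; exact not_br_b hbr'
  · rcases he with rfl | rfl
    · refine ⟨tau * k, mul_mem (K_le_GG (perm_mem (by simp))) hkG, Or.inl fun x => ?_⟩
      rw [hg_mul, hx]; exact tau_f0 x
    · exfalso; rw [tau_a] at hbr'
      simp only [fw_cons, fw_nil, f_zero_b] at hbr'
      exact not_br_a hbr'
  · rcases he with rfl | rfl
    · exact ⟨k, hkG, Or.inl hx⟩
    · exfalso; rw [tau_a] at hbr'
      simp only [fw_cons, fw_nil, f_one_b] at hbr'
      exact not_br_b hbr'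
  · rcases he with rfl | rfl
    · exact ⟨k, hkG, Or.inr (Or.inl hx)⟩
    · exact ⟨k, hkG, Or.inr (Or.inr hx)⟩

end Waz

namespace Waz
variable {m : ℕ}

theorem letters_aux (w : List (Fin (m + 3))) (hw : ∃ i ∈ w, i ≠ 0 ∧ i ≠ 1) :
    ∃ C : Set (WX m), IsPreconnected C ∧ a ∈ C ∧ b ∈ C ∧ fw w c ∉ C := by
  have main : ∀ C' : Set (WX m), IsPreconnected C' → a ∈ C' → b ∈ C' →
      IsPreconnected (f 0 '' C' ∪ f 1 '' C') ∧ a ∈ f 0 '' C' ∪ f 1 '' C' ∧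
        b ∈ f 0 '' C' ∪ f 1 '' C' := by
    intro C' hC' ha hb
    refine ⟨IsPreconnected.union c ⟨a, ha, f_a_eq _⟩ ⟨a, ha, f_a_eq _⟩
      (hC'.image _ (continuous_f _).continuousOn) (hC'.image _ (continuous_f _).continuousOn),
      Or.inl ⟨b, hb, f_zero_b⟩, Or.inr ⟨b, hb, f_one_b⟩⟩
  induction w with
  | nil => simp at hw
  | cons i w ih =>
    by_cases hi : i ≠ 0 ∧ i ≠ 1
    · obtain ⟨h1, h2, h3⟩ := main Set.univ isPreconnected_univ trivial trivial
      refine ⟨_, h1, h2, h3, ?_⟩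
      rintro (⟨y, -, hy⟩ | ⟨y, -, hy⟩)
      · exact fw_c_ne_a w ((f_eq_of_ne hi.1.symm).1 hy).2
      · exact fw_c_ne_a w ((f_eq_of_ne hi.2.symm).1 hy).2
    · have hw' : ∃ i ∈ w, i ≠ 0 ∧ i ≠ 1 := by
        obtain ⟨j, hj, hj'⟩ := hw
        rcases List.mem_cons.1 hj with rfl | hj
        · contradiction
        · exact ⟨j, hj, hj'⟩
      obtain ⟨C', hC', ha, hb, hn⟩ := ih hw'
      obtain ⟨h1, h2, h3⟩ := main C' hC' ha hb
      have key : ∀ j : Fin (m + 3), f i (fw w c) ∉ f j '' C' := by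
        rintro j ⟨y, hy, h⟩
        by_cases hj : j = i
        · subst hj
          rw [f_inj] at h
          exact hn (h ▸ hy)
        · exact fw_c_ne_a w ((f_eq_of_ne hj).1 h).2
      exact ⟨_, h1, h2, h3, fun h => h.elim (key 0) (key 1)⟩

theorem a_mem_brn : (a : WX m) ∈ brn 0 := by
  rw [← f_zero_b, f_mem_brn]; exact ⟨rfl, a_ne_b.symm⟩

theorem b_mem_brn : (b : WX m) ∈ brn 1 := by
  rw [← f_one_b, f_mem_brn]; exact ⟨rfl, a_ne_b.symm⟩

theorem letters {h : HG m} (ha : h a = a) (hb : h b = b) {w : List (Fin (m + 3))}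
    (hc : h c = fw w c) : ∀ i ∈ w, i = 0 ∨ i = 1 := by
  by_contra hcon
  push Not at hcon
  obtain ⟨C, hC, haC, hbC, hn⟩ := letters_aux w hcon
  have h1 : IsPreconnected (h.symm '' C) := hC.image _ h.symm.continuous.continuousOn
  have hac : (a : WX m) ∈ h.symm '' C := ⟨a, haC, hg_inv_eq ha⟩
  have hbc : (b : WX m) ∈ h.symm '' C := ⟨b, hbC, hg_inv_eq hb⟩
  have hcc : (c : WX m) ∉ h.symm '' C := by
    rintro ⟨y, hy, e⟩
    apply hn
    rw [← hc, ← e, h.apply_symm_apply]; exact hy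
  have := preconn_subset_brn h1 hcc hac a_mem_brn hbc
  exact one_ne_zero' (mem_brn_unique b_mem_brn this)

theorem range_f (i : Fin (m + 3)) : Set.range (f i : WX m → WX m) = insert c (brn i) := by
  ext x
  constructor
  · rintro ⟨y, rfl⟩
    by_cases hy : y = a
    · left; rw [hy, f_a_eq]
    · right; exact ⟨y, hy, rfl⟩
  · rintro (rfl | ⟨y, -, rfl⟩)
    · exact ⟨a, f_a_eq _⟩
    · exact ⟨y, rfl⟩

theorem core {A : Set (Fin (m + 3))} (hA : A ⊆ {0} ∨ A = {0, 1}) (h : HG m)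
    (ha : 0 ∈ A → h a = a) (hb : 1 ∈ A → h b = b) :
    ∃ k ∈ K A, (∀ i, (k * h) '' Set.range (f i) = Set.range (f i)) ∧ (k * h) c = c := by
  obtain ⟨w, hw⟩ := (br_homeo h c).2 br_c
  have hok : Ok A w := by
    rcases hA with hA | rfl
    · exact Or.inl hA
    · exact Or.inr (letters (ha (by simp)) (hb (by simp)) hw)
  obtain ⟨g, hg, hgc⟩ := trans_c hok
  have h1c : (g * h) c = c := by rw [hg_mul, hw, hgc]
  have hex : ∀ i : Fin (m + 3), ∃ j, (g * h) '' brn i = brn j := by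
    intro i
    have h1 := comps_homeo (g * h) c
    rw [h1c, comps_c] at h1
    have : (g * h) '' brn i ∈ Set.range (brn (m := m)) := by
      rw [h1]; exact ⟨brn i, ⟨i, rfl⟩, rfl⟩
    obtain ⟨j, hj⟩ := this
    exact ⟨j, hj.symm⟩
  choose s hs using hex
  have hsinj : Function.Injective s := by
    intro i j hij
    apply brn_inj
    apply (g * h).injective.image_injective
    rw [hs, hs, hij]
  let σ : Equiv.Perm (Fin (m + 3)) := Equiv.ofBijective s (Finite.injective_iff_bijective.1 hsinj)
  have hσ : ∀ i, σ i = s i := fun _ => rfl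
  have hσA : ∀ i ∈ A, σ i = i := by
    have h0 : 0 ∈ A → s 0 = 0 := by
      intro h0
      have : (g * h) a ∈ brn (s 0) := by rw [← hs]; exact ⟨a, a_mem_brn, rfl⟩
      rw [hg_mul, ha h0, K_a h0 hg] at this
      exact mem_brn_unique this a_mem_brn
    have h1 : 1 ∈ A → s 1 = 1 := by
      intro h0
      have : (g * h) b ∈ brn (s 1) := by rw [← hs]; exact ⟨b, b_mem_brn, rfl⟩
      rw [hg_mul, hb h0, K_b h0 hg] at this
      exact mem_brn_unique this b_mem_brn
    intro i hi
    have : i = 0 ∨ i = 1 := by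
      rcases hA with hA | rfl
      · exact Or.inl (hA hi)
      · exact hi
    rcases this with rfl | rfl
    · exact h0 hi
    · exact h1 hi
  have hcc : (perm σ⁻¹ * g * h) c = c := by
    rw [mul_assoc, hg_mul, h1c, perm_c]
  refine ⟨perm σ⁻¹ * g, mul_mem (perm_mem fun i hi => ?_) hg, fun i => ?_, hcc⟩
  · rw [Equiv.Perm.inv_eq_iff_eq, hσA i hi]
  · rw [range_f, Set.image_insert_eq, hcc]
    congr 1
    have : (perm σ⁻¹ * g * h : HG m) '' brn i = perm σ⁻¹ '' ((g * h) '' brn i) := by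
      rw [Set.image_image]; rfl
    rw [this, hs]
    unfold brn
    rw [Set.image_image, ← hσ]
    have hinv : σ⁻¹ (σ i) = i := σ.symm_apply_apply i
    simp only [perm_f, hinv]

theorem isEmbedding_fw (w : List (Fin (m + 3))) : IsEmbedding (fw w : WX m → WX m) :=
  ((continuous_fw w).isClosedEmbedding fun _ _ h => fw_inj.1 h).isEmbedding

theorem restrict {h : HG m} {w : List (Fin (m + 3))}
    (hw : h '' Set.range (fw w) = Set.range (fw w)) :
    ∃ g : HG m, ∀ x, h (fw w x) = fw w (g x) := by
  have h1 : ∀ x, ∃ y, fw w y = h (fw w x) := by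
    intro x
    have : h (fw w x) ∈ Set.range (fw w) := by rw [← hw]; exact ⟨_, ⟨x, rfl⟩, rfl⟩
    exact this
  have h2 : ∀ x, ∃ y, fw w y = h.symm (fw w x) := by
    intro x
    have : fw w x ∈ h '' Set.range (fw w) := by rw [hw]; exact ⟨x, rfl⟩
    obtain ⟨_, ⟨y, rfl⟩, e⟩ := this
    exact ⟨y, by rw [← e, h.symm_apply_apply]⟩
  choose F hF using h1
  choose F' hF' using h2
  refine ⟨mkH F F' ?_ ?_ ?_ ?_, fun x => (hF x).symm⟩
  · rw [(isEmbedding_fw w).continuous_iff]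
    have : fw w ∘ F = h ∘ fw w := funext hF
    rw [this]; exact h.continuous.comp (continuous_fw w)
  · rw [(isEmbedding_fw w).continuous_iff]
    have : fw w ∘ F' = h.symm ∘ fw w := funext hF'
    rw [this]; exact h.symm.continuous.comp (continuous_fw w)
  · intro x
    apply (fw_inj (w := w)).1
    rw [hF', hF, h.symm_apply_apply]
  · intro x
    apply (fw_inj (w := w)).1
    rw [hF, hF', h.apply_symm_apply]

end Waz

namespace Waz
variable {m : ℕ}

theorem hg_image (g h : HG m) (S : Set (WX m)) : (g * h) '' S = g '' (h '' S) := by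
  rw [Set.image_image]; rfl

theorem hg_image_inv (g : HG m) (S : Set (WX m)) : (g⁻¹ : HG m) '' (g '' S) = S := by
  rw [← hg_image, inv_mul_cancel]; exact Set.image_id S

theorem range_append (w : List (Fin (m + 3))) (i : Fin (m + 3)) :
    Set.range (fw (w ++ [i]) : WX m → WX m) = fw w '' Set.range (f i) := by
  rw [← Set.range_comp]
  congr 1
  funext x
  rw [fw_append]; rfl

/-- What we want of a refinement. -/
def Refines (w : List (Fin (m + 3))) (h k : HG m) : Prop :=
  k ∈ GG m ∧ (∀ x ∉ Set.range (fw w : WX m → WX m), k x = x) ∧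
    (∀ y, y = a ∨ y = b → Br (fw w y) → k (fw w y) = fw w y) ∧
    k '' Set.range (fw w) = Set.range (fw w) ∧
    (∀ i, (k * h) '' Set.range (fw (w ++ [i])) = Set.range (fw (w ++ [i]))) ∧
    (k * h) (fw w c) = fw w c

theorem refines_aux {w : List (Fin (m + 3))} {h k h' k' : HG m} (hk : k ∈ GG m)
    (hoff : ∀ x ∉ Set.range (fw w : WX m → WX m), k x = x)
    (hh : ∀ x, h (fw w x) = fw w (h' x)) (hkk : ∀ x, k (fw w x) = fw w (k' x))
    (hend : ∀ y, y = a ∨ y = b → Br (fw w y) → k' y = y)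
    (hi : ∀ i, (k' * h') '' Set.range (f i) = Set.range (f i)) (hc : (k' * h') c = c) :
    Refines w h k := by
  have hkh : ∀ x, (k * h) (fw w x) = fw w ((k' * h') x) := by
    intro x; rw [hg_mul, hh, hkk, hg_mul]
  refine ⟨hk, hoff, fun y hy hb => by rw [hkk, hend y hy hb], ?_, fun i => ?_, ?_⟩
  · rw [← Set.range_comp]
    have : k ∘ fw w = fw w ∘ k' := funext hkk
    rw [this, Set.range_comp, k'.surjective.range_eq, Set.image_univ]
  · rw [range_append]
    conv_rhs => rw [← hi i]
    rw [Set.image_image, Set.image_image]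
    simp only [hkh]
  · rw [hkh, hc]

theorem br_end {w : List (Fin (m + 3))} (hw : w ≠ []) : Br (fw w (a : WX m)) := by
  rcases List.eq_nil_or_concat w with h | ⟨v, i, rfl⟩
  · contradiction
  · rw [List.concat_eq_append, fw_append]
    exact ⟨v, by simp [f_a_eq]⟩

theorem refine_inner {w : List (Fin (m + 3))} {h h' g e : HG m} (hg : g ∈ GG m)
    (hge : ∀ x, g (fw w x) = f 1 (f 0 (e x)))
    (hh : ∀ x, h (fw w x) = fw w (h' x)) (ha : h' a = a) (hb : h' b = b)
    (hee : e * e = 1) (heab : (e a = a ∧ e b = b) ∨ (e a = b ∧ e b = a)) (hec : e c = c)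
    (s : Fin (m + 3) → Fin (m + 3))
    (hs : ∀ i, e '' Set.range (f i) = Set.range (f (s i))) : ∃ k, Refines w h k := by
  have hee' : ∀ x, e (e x) = x := fun x => by rw [← hg_mul, hee, hg_one]
  have ha' : (e * h' * e) a = a := by
    rw [hg_mul, hg_mul]
    rcases heab with ⟨h1, h2⟩ | ⟨h1, h2⟩
    · rw [h1, ha, h1]
    · rw [h1, hb, h2]
  have hb' : (e * h' * e) b = b := by
    rw [hg_mul, hg_mul]
    rcases heab with ⟨h1, h2⟩ | ⟨h1, h2⟩
    · rw [h2, hb, h2]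
    · rw [h2, ha, h1]
  obtain ⟨k', hk', hi, hc⟩ := core (A := {0, 1}) (Or.inr rfl) (e * h' * e) (fun _ => ha')
    (fun _ => hb')
  have ka : k' a = a := K_a (by simp) hk'
  have kb : k' b = b := K_b (by simp) hk'
  have hext : ∀ x, ext 1 (ext 0 k') (f 1 (f 0 x)) = f 1 (f 0 (k' x)) := by
    intro x
    rw [ext_same 1 (ext0_a ka kb), ext_same 0 ka]
  have hprod : e * k' * e * h' = e * (k' * (e * h' * e)) * e := by
    simp only [mul_assoc, hee, mul_one]
  refine ⟨g⁻¹ * ext 1 (ext 0 k') * g, refines_aux (h' := h') (k' := e * k' * e)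
    (mul_mem (mul_mem (inv_mem hg) (ext10_mem hk')) hg) ?_ hh ?_ ?_ ?_ ?_⟩
  · intro x hx
    rw [hg_mul, hg_mul]
    apply hg_inv_eq
    obtain ⟨j, y, hy⟩ := f_surj (g x)
    rw [hy]
    by_cases hj : j = 1
    swap
    · rw [ext_ne _ hj]
    subst hj
    obtain ⟨j, z, rfl⟩ := f_surj y
    by_cases hj : j = 0
    swap
    · rw [ext_same 1 (ext0_a ka kb), ext_ne _ hj]
    subst hj
    exfalso
    apply hx
    refine ⟨e z, g.injective ?_⟩
    rw [hge, hee', hy]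
  · intro x
    rw [hg_mul, hg_mul, hge, hext]
    apply hg_inv_eq
    rw [hge, hg_mul, hg_mul, hee']
  · intro y hy _
    rw [hg_mul, hg_mul]
    rcases heab with ⟨h1, h2⟩ | ⟨h1, h2⟩ <;> rcases hy with rfl | rfl <;> simp [h1, h2, ka, kb]
  · intro i
    rw [hprod, hg_image, hg_image, hs, hi, ← hs, ← hg_image, hee]
    exact Set.image_id _
  · rw [hprod, hg_mul, hg_mul, hec, hc, hec]

theorem tau_image (i : Fin (m + 3)) :
    tau '' Set.range (f i : WX m → WX m) = Set.range (f (Equiv.swap 0 1 i)) := by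
  rw [← Set.range_comp]
  congr 1
  funext x
  exact tau_f i x

theorem refine_cell (w : List (Fin (m + 3))) (h : HG m)
    (hw : h '' Set.range (fw w) = Set.range (fw w))
    (hfix : ∀ y, y = a ∨ y = b → Br (fw w y) → h (fw w y) = fw w y) : ∃ k, Refines w h k := by
  obtain ⟨h', hh⟩ := restrict hw
  have hfix' : ∀ y, y = a ∨ y = b → Br (fw w y) → h' y = y := by
    intro y hy hb
    rw [← fw_inj (w := w), ← hh, hfix y hy hb]
  by_cases hnil : w = []
  · subst hnil
    obtain ⟨k, hk, hi, hc⟩ := core (A := ∅) (Or.inl (Set.empty_subset _)) h'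
      (fun h => absurd h (Set.notMem_empty _)) (fun h => absurd h (Set.notMem_empty _))
    refine ⟨k, refines_aux (h' := h') (k' := k) (K_le_GG hk) ?_ hh (fun _ => rfl) ?_ hi hc⟩
    · intro x hx; exact absurd ⟨x, rfl⟩ hx
    · rintro y (rfl | rfl) hb
      · exact absurd hb not_br_a
      · exact absurd hb not_br_b
  have ha : h' a = a := hfix' a (Or.inl rfl) (br_end hnil)
  obtain ⟨g, hg, hge | hge⟩ := cell hnil
  · obtain ⟨k', hk', hi, hc⟩ := core (A := {0}) (Or.inl le_rfl) h' (fun _ => ha)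
      (fun h => absurd h one_ne_zero')
    have ka : k' a = a := K_a (Set.mem_singleton _) hk'
    refine ⟨g⁻¹ * ext 1 k' * g, refines_aux (h' := h') (k' := k')
      (mul_mem (mul_mem (inv_mem hg) (ext1_mem hk')) hg) ?_ hh ?_ ?_ hi hc⟩
    · intro x hx
      rw [hg_mul, hg_mul]
      apply hg_inv_eq
      obtain ⟨j, y, hy⟩ := f_surj (g x)
      rw [hy]
      by_cases hj : j = 1
      swap
      · rw [ext_ne _ hj]
      subst hj
      exfalso
      exact hx ⟨y, g.injective (by rw [hge, hy])⟩
    · intro x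
      rw [hg_mul, hg_mul, hge, ext_same 1 ka]
      apply hg_inv_eq
      rw [hge]
    · rintro y (rfl | rfl) hb
      · exact ka
      · rw [← br_homeo g, hge, f_one_b] at hb
        exact absurd hb not_br_b
  · have hb : h' b = b := by
      apply hfix' b (Or.inr rfl)
      rw [← br_homeo g]
      rcases hge with hge | hge
      · rw [hge, f_zero_b, f_a_eq]; exact br_c
      · rw [hge, tau_b, f_a_eq]; exact br_c.f 1
    rcases hge with hge | hge
    · exact refine_inner (e := 1) hg hge hh ha hb (mul_one _) (Or.inl ⟨rfl, rfl⟩) rfl id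
        (fun i => Set.image_id _)
    · exact refine_inner (e := tau) hg hge hh ha hb (Homeomorph.ext tau_tau)
        (Or.inr ⟨tau_a, tau_b⟩) tau_c _ tau_image

theorem cells_meet {w w' : List (Fin (m + 3))} (hl : w.length = w'.length) (hne : w ≠ w')
    {x y : WX m} (h : fw w x = fw w' y) : ∃ u, u.length < w.length ∧ fw w x = fw u c := by
  induction w generalizing w' with
  | nil =>
    exact absurd (List.length_eq_zero_iff.1 hl.symm).symm hne
  | cons i w ih =>
    rcases w' with _ | ⟨j, w'⟩
    · simp at hl
    simp only [fw_cons] at h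
    by_cases hij : i = j
    · subst hij
      obtain ⟨u, hu, e⟩ := ih (by simpa using hl) (fun e => hne (by rw [e])) (f_inj.1 h)
      exact ⟨i :: u, by simpa using hu, by simp [e]⟩
    · exact ⟨[], by simp, by simp [((f_eq_of_ne hij).1 h).1, f_a_eq]⟩

theorem br_in_cell {u w : List (Fin (m + 3))} (hl : u.length < w.length)
    {y : WX m} (h : fw u c = fw w y) : y = a ∨ y = b := by
  induction w generalizing u with
  | nil => simp at hl
  | cons i w ih =>
    rcases u with _ | ⟨j, u⟩
    · exact fw_eq_a (f_eq_c.1 h.symm)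
    · simp only [fw_cons] at h
      by_cases hij : j = i
      · subst hij
        exact ih (by simpa using hl) (f_inj.1 h)
      · exact fw_eq_a ((f_eq_of_ne hij).1 h).2

theorem end_lt {u w : List (Fin (m + 3))} {y : WX m} (hy : y = a ∨ y = b)
    (h : fw w y = fw u c) : u.length < w.length := by
  induction w generalizing u with
  | nil =>
    rcases hy with rfl | rfl
    · exact absurd h.symm (fw_c_ne_a u)
    · exact absurd h.symm (fw_c_ne_b u)
  | cons i w ih =>
    rcases u with _ | ⟨j, u⟩
    · simp
    · simp only [fw_cons] at h
      by_cases hij : i = j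
      · subst hij
        simpa using ih (f_inj.1 h)
      · exact absurd ((f_eq_of_ne hij).1 h).2 (fw_c_ne_a u)

/-- The invariant. -/
def Inva (k : ℕ) (h : HG m) : Prop :=
  (∀ w : List (Fin (m + 3)), w.length = k → h '' Set.range (fw w) = Set.range (fw w)) ∧
    ∀ u : List (Fin (m + 3)), u.length < k → h (fw u c) = fw u c

theorem image_fixed {k : HG m} {S : Set (WX m)} (h : ∀ x ∈ S, k x = x) : k '' S = S := by
  rw [Set.image_congr h]; simp

theorem inv_step_aux (k : ℕ) (h : HG m) (hI : Inva k h) (S : Finset (List (Fin (m + 3))))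
    (hS : ∀ w ∈ S, w.length = k) : ∃ g ∈ GG m, Inva k (g * h) ∧ ∀ w ∈ S,
      (∀ i, (g * h) '' Set.range (fw (w ++ [i])) = Set.range (fw (w ++ [i]))) ∧
      (g * h) (fw w c) = fw w c := by
  classical
  induction S using Finset.induction_on with
  | empty => exact ⟨1, one_mem _, by rwa [one_mul], by simp⟩
  | insert w S hwS ih =>
    obtain ⟨g, hg, ⟨hI1, hI2⟩, hgS⟩ := ih fun w hw => hS w (Finset.mem_insert_of_mem hw)
    have hwk : w.length = k := hS w (Finset.mem_insert_self _ _)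
    obtain ⟨q, hq, hoff, hend, hcell, hi, hc⟩ := refine_cell w (g * h) (hI1 w hwk) (by
      intro y hy ⟨u, hu⟩
      rw [hu]
      exact hI2 u (hwk ▸ end_lt hy hu))
    have hbr : ∀ u : List (Fin (m + 3)), u.length < k → q (fw u c) = fw u c := by
      intro u hu
      by_cases hr : fw u c ∈ Set.range (fw w : WX m → WX m)
      · obtain ⟨y, hy⟩ := hr
        rw [← hy]
        exact hend y (br_in_cell (hwk.symm ▸ hu) hy.symm) ⟨u, hy⟩
      · exact hoff _ hr
    have hother : ∀ w' : List (Fin (m + 3)), w'.length = k → w' ≠ w →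
        ∀ x ∈ Set.range (fw w' : WX m → WX m), q x = x := by
      rintro w' hw' hne _ ⟨x, rfl⟩
      by_cases hr : fw w' x ∈ Set.range (fw w : WX m → WX m)
      · obtain ⟨y, hy⟩ := hr
        obtain ⟨u, hu, e⟩ := cells_meet (hw'.trans hwk.symm) hne hy.symm
        rw [e]
        exact hbr u (hw' ▸ hu)
      · exact hoff _ hr
    refine ⟨q * g, mul_mem hq hg, ⟨fun w' hw' => ?_, fun u hu => ?_⟩, fun w' hw' => ?_⟩
    · rw [mul_assoc, hg_image, hI1 w' hw']
      by_cases hne : w' = w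
      · subst hne; exact hcell
      · exact image_fixed (hother w' hw' hne)
    · rw [mul_assoc, hg_mul, hI2 u hu, hbr u hu]
    · rw [mul_assoc]
      rcases Finset.mem_insert.1 hw' with rfl | hw''
      · exact ⟨hi, hc⟩
      · have hne : w' ≠ w := fun e => hwS (e ▸ hw'')
        have hfx := hother w' (hS w' hw') hne
        refine ⟨fun i => ?_, ?_⟩
        · rw [hg_image, (hgS w' hw'').1 i]
          apply image_fixed
          rintro _ ⟨x, rfl⟩
          apply hfx
          rw [fw_append]; exact ⟨_, rfl⟩
        · rw [hg_mul, (hgS w' hw'').2]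
          exact hfx _ ⟨_, rfl⟩

theorem exists_inv (h : HG m) (k : ℕ) : ∃ g ∈ GG m, Inva k (g * h) := by
  induction k with
  | zero =>
    refine ⟨1, one_mem _, fun w hw => ?_, fun u hu => by simp at hu⟩
    rw [List.length_eq_zero_iff] at hw
    subst hw
    have : Set.range (fw [] : WX m → WX m) = Set.univ := Set.range_id
    rw [this, Set.image_univ]
    exact (1 * h : HG m).surjective.range_eq
  | succ k ih =>
    obtain ⟨g, hg, hI⟩ := ih
    obtain ⟨q, hq, hI', hS⟩ := inv_step_aux k (g * h) hI (finite_words k).toFinset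
      (fun w hw => by simpa using hw)
    have hS' : ∀ w : List (Fin (m + 3)), w.length = k →
        (∀ i, (q * (g * h)) '' Set.range (fw (w ++ [i])) = Set.range (fw (w ++ [i]))) ∧
        (q * (g * h)) (fw w c) = fw w c := fun w hw => hS w (by simpa using hw)
    refine ⟨q * g, mul_mem hq hg, ?_, ?_⟩
    · intro w hw
      rcases List.eq_nil_or_concat w with rfl | ⟨v, i, rfl⟩
      · simp at hw
      · rw [List.concat_eq_append] at hw ⊢
        rw [mul_assoc]
        exact (hS' v (by simpa using hw)).1 i
    · intro u hu
      rw [mul_assoc]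
      rcases Nat.lt_succ_iff_lt_or_eq.1 hu with hu | hu
      · exact hI'.2 u hu
      · exact (hS' u hu).2

theorem exists_approx (h : HG m) (k : ℕ) : ∃ g ∈ GG m, ∀ w : List (Fin (m + 3)), w.length = k →
    g '' Set.range (fw w) = h '' Set.range (fw w) := by
  obtain ⟨g, hg, hI⟩ := exists_inv h k
  refine ⟨g⁻¹, inv_mem hg, fun w hw => ?_⟩
  conv_lhs => rw [← hI.1 w hw, hg_image]
  rw [hg_image_inv]

theorem GG_dense : Dense (GG m : Set (HG m)) := by
  intro h
  choose g hg hgw using exists_approx h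
  refine mem_closure_of_tendsto (f := g) (b := Filter.atTop) ?_ (Filter.Eventually.of_forall hg)
  rw [nhds_induced, Filter.tendsto_comap_iff]
  rw [ContinuousMap.tendsto_nhds_compactOpen]
  intro Kc hK U hU hm
  obtain ⟨k₀, hk⟩ := shrink hK (hU.preimage h.continuous) hm
  filter_upwards [Filter.eventually_ge_atTop k₀] with k hkk
  intro x hx
  obtain ⟨w, hw, y, hy⟩ := fw_surj k x
  have hsub := hk k hkk w hw ⟨x, hx, y, hy.symm⟩
  have : g k x ∈ h '' Set.range (fw w) := by
    rw [← hgw k w hw]; exact ⟨x, ⟨y, hy.symm⟩, rfl⟩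
  obtain ⟨z, hz, e⟩ := this
  have := hsub hz
  rw [Set.mem_preimage, e] at this
  exact this

theorem perm_brn (σ : Equiv.Perm (Fin (m + 3))) (i : Fin (m + 3)) :
    perm σ '' (brn i : Set (WX m)) = brn (σ i) := by
  unfold brn
  rw [Set.image_image]
  simp only [perm_f]

theorem local_action (p : WX m) (hp : ptOrder (WX m) p = m + 3)
    (σ : Equiv.Perm (setComponents (WX m) {p}ᶜ)) : ∃ g ∈ GG m, (g : HG m) p = p ∧
      ∀ B : setComponents (WX m) {p}ᶜ, g '' (B : Set (WX m)) = ((σ B : Set (WX m))) := by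
  obtain ⟨w, rfl⟩ := br_iff.2 hp
  obtain ⟨g0, hg0, hgc⟩ := trans_c (A := ∅) (w := w) (Or.inl (Set.empty_subset _))
  have hgc' : g0⁻¹ c = fw w c := hg_inv_eq hgc
  have hcomp : setComponents (WX m) {fw w c}ᶜ = Set.range fun i => (g0⁻¹ : HG m) '' brn i := by
    rw [← hgc', comps_homeo, comps_c, ← Set.range_comp]; rfl
  have hmem : ∀ i, (g0⁻¹ : HG m) '' brn i ∈ setComponents (WX m) {fw w c}ᶜ := by
    intro i; rw [hcomp]; exact ⟨i, rfl⟩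
  have hinj : Function.Injective fun i : Fin (m + 3) => (g0⁻¹ : HG m) '' brn i :=
    fun i j h => brn_inj ((g0⁻¹).injective.image_injective h)
  have hex : ∀ i, ∃ j, ((σ ⟨_, hmem i⟩ : setComponents (WX m) {fw w c}ᶜ) : Set (WX m)) =
      (g0⁻¹ : HG m) '' brn j := by
    intro i
    have hall : ∀ C ∈ setComponents (WX m) {fw w c}ᶜ, ∃ j, (g0⁻¹ : HG m) '' brn j = C := by
      intro C hC
      rw [hcomp] at hC
      exact hC
    obtain ⟨j, hj⟩ := hall _ (σ ⟨_, hmem i⟩).2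
    exact ⟨j, hj.symm⟩
  choose s hs using hex
  have hsinj : Function.Injective s := by
    intro i j hij
    apply hinj
    have h1 : σ ⟨_, hmem i⟩ = σ ⟨_, hmem j⟩ := Subtype.ext (by rw [hs, hs, hij])
    exact congrArg Subtype.val (σ.injective h1)
  let ρ : Equiv.Perm (Fin (m + 3)) := Equiv.ofBijective s (Finite.injective_iff_bijective.1 hsinj)
  have hρ : ∀ i, ρ i = s i := fun _ => rfl
  refine ⟨g0⁻¹ * perm ρ * g0, mul_mem (mul_mem (inv_mem (K_le_GG hg0))
    (K_le_GG (perm_mem (by simp)))) (K_le_GG hg0), ?_, ?_⟩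
  · rw [hg_mul, hg_mul, hgc, perm_c, hgc']
  · rintro ⟨B, hB⟩
    have hB' := hB
    rw [hcomp] at hB'
    obtain ⟨i, rfl⟩ := hB'
    rw [hs i, ← hρ, hg_image, hg_image, ← hg_image g0, mul_inv_cancel]
    rw [show (1 : HG m) '' brn i = brn i from Set.image_id _, perm_brn]

end Waz

theorem statement11 (n : ℕ) (hn : 3 ≤ n) :
    ∃ (X : Type) (_ : TopologicalSpace X) (_ : IsWazewskiDendrite n X)
      (G : Subgroup (X ≃ₜ X)),
      G.FG ∧ Dense (G : Set (X ≃ₜ X)) ∧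
      ∀ p : X, ptOrder X p = n →
        ∀ σ : Equiv.Perm (setComponents X {p}ᶜ),
          ∃ g ∈ G, (g : X ≃ₜ X) p = p ∧
            ∀ B : setComponents X {p}ᶜ,
              (g : X ≃ₜ X) '' (B : Set X) = ((σ B : Set X)) := by
  obtain ⟨m, rfl⟩ : ∃ m, n = m + 3 := ⟨n - 3, by omega⟩
  exact ⟨Waz.WX m, inferInstance, Waz.wazewski, Waz.GG m, Waz.GG_fg, Waz.GG_dense,
    fun p hp σ => Waz.local_action p hp σ⟩
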